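/- For every i ∈ Î and every x ∈ U⁺, one has r_i(x) = 0 if and only if T_i^{−1}(x) ∈ U⁺; in other words, {x ∈ U⁺ : r_i(x) = 0} = {x ∈ U⁺ : T_i^{−1}(x) ∈ U⁺}. -/

import Mathlib

open scoped BigOperators TensorProduct

noncomputable section

/-- The base field `K = ℚ(q)` of rational functions over `ℚ`. -/
abbrev Kq : Type := RatFunc ℚ

/-- The element `q ∈ ℚ(q)`. -/
def qvar : Kq := RatFunc.X

/-- Generators of the quantum affine algebra: `E_i`, `F_i`, `K_i`, `K_i⁻¹`, `γ^{1/2}`,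
`γ^{-1/2}`. -/
inductive Gen (n : ℕ) : Type
  | E : Fin n → Gen n
  | F : Fin n → Gen n
  | K : Fin n → Gen n
  | Kinv : Fin n → Gen n
  | g : Gen n
  | ginv : Gen n

variable {n : ℕ}

/-- The free algebra on the generators. -/
abbrev FA (n : ℕ) : Type := FreeAlgebra Kq (Gen n)

/-- Inclusion of the generators into the free algebra. -/
def ι : Gen n → FA n := FreeAlgebra.ι Kq

/-- `q_i = q^{d_i}`. -/
def qi (d : Fin n → ℕ) (i : Fin n) : Kq := qvar ^ (d i)

/-- The quantum integer `[m]_i = (q_i^m - q_i^{-m})/(q_i - q_i⁻¹)`. -/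
def qint (d : Fin n → ℕ) (i : Fin n) (m : ℤ) : Kq :=
  (qi d i ^ m - qi d i ^ (-m)) / (qi d i - (qi d i)⁻¹)

/-- The quantum factorial `[m]_i!`. -/
def qfact (d : Fin n → ℕ) (i : Fin n) : ℕ → Kq
  | 0 => 1
  | m + 1 => qfact d i m * qint d i (m + 1)

/-- The quantum binomial coefficient `[m choose s]_i`. -/
def qbinom (d : Fin n → ℕ) (i : Fin n) (m s : ℕ) : Kq :=
  qfact d i m / (qfact d i s * qfact d i (m - s))

/-- The quantum Serre element `∑_{s=0}^{1-a_{ij}} (-1)^s [1-a_{ij} choose s]_i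
E_i^{1-a_{ij}-s} E_j E_i^s` in the free algebra. -/
def serreE (a : Fin n → Fin n → ℤ) (d : Fin n → ℕ) (i j : Fin n) : FA n :=
  ∑ s ∈ Finset.range ((1 - a i j).toNat + 1),
    ((-1 : Kq) ^ s * qbinom d i (1 - a i j).toNat s) •
      (ι (Gen.E i) ^ ((1 - a i j).toNat - s) * ι (Gen.E j) * ι (Gen.E i) ^ s)

/-- The quantum Serre element in the `F`'s. -/
def serreF (a : Fin n → Fin n → ℤ) (d : Fin n → ℕ) (i j : Fin n) : FA n :=
  ∑ s ∈ Finset.range ((1 - a i j).toNat + 1),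
    ((-1 : Kq) ^ s * qbinom d i (1 - a i j).toNat s) •
      (ι (Gen.F i) ^ ((1 - a i j).toNat - s) * ι (Gen.F j) * ι (Gen.F i) ^ s)

/-- The defining relations of the quantum affine algebra `U_q`. -/
inductive QRel (a : Fin n → Fin n → ℤ) (d r : Fin n → ℕ) : FA n → FA n → Prop
  | KKinv (i : Fin n) : QRel a d r (ι (Gen.K i) * ι (Gen.Kinv i)) 1
  | KinvK (i : Fin n) : QRel a d r (ι (Gen.Kinv i) * ι (Gen.K i)) 1
  | gginv : QRel a d r (ι Gen.g * ι Gen.ginv) 1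
  | ginvg : QRel a d r (ι Gen.ginv * ι Gen.g) 1
  | gcomm (x : Gen n) : QRel a d r (ι Gen.g * ι x) (ι x * ι Gen.g)
  | gsq : QRel a d r (ι Gen.g * ι Gen.g)
      (((List.finRange n).map fun i => ι (Gen.K i) ^ r i).prod)
  | KK (i j : Fin n) : QRel a d r (ι (Gen.K i) * ι (Gen.K j)) (ι (Gen.K j) * ι (Gen.K i))
  | KE (i j : Fin n) : QRel a d r (ι (Gen.K i) * ι (Gen.E j))
      ((qi d i ^ (a i j)) • (ι (Gen.E j) * ι (Gen.K i)))
  | KF (i j : Fin n) : QRel a d r (ι (Gen.K i) * ι (Gen.F j))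
      ((qi d i ^ (-(a i j))) • (ι (Gen.F j) * ι (Gen.K i)))
  | EF (i j : Fin n) : QRel a d r (ι (Gen.E i) * ι (Gen.F j) - ι (Gen.F j) * ι (Gen.E i))
      (if i = j then ((qi d i - (qi d i)⁻¹)⁻¹) • (ι (Gen.K i) - ι (Gen.Kinv i)) else 0)
  | serreEE (i j : Fin n) (h : i ≠ j) : QRel a d r (serreE a d i j) 0
  | serreFF (i j : Fin n) (h : i ≠ j) : QRel a d r (serreF a d i j) 0

/-- The quantum affine algebra `U_q`, presented by the generators and relations above. -/
abbrev Uq (a : Fin n → Fin n → ℤ) (d r : Fin n → ℕ) : Type := RingQuot (QRel a d r)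

/-- The images of the generators in `U_q`. -/
def gen (a : Fin n → Fin n → ℤ) (d r : Fin n → ℕ) (x : Gen n) : Uq a d r :=
  RingQuot.mkAlgHom Kq (QRel a d r) (ι x)

/-- The hypotheses on the Cartan data: `A = (a_{ij})` is a symmetrizable generalized Cartan
matrix with symmetrizing positive integers `d_i`, and the positive integers `r_i` satisfy
`∑_i r_i d_i a_{ij} = 0` for all `j`. -/
structure CartanData (n : ℕ) (a : Fin n → Fin n → ℤ) (d r : Fin n → ℕ) : Prop where
  diag : ∀ i, a i i = 2
  offdiag : ∀ i j, i ≠ j → a i j ≤ 0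
  zero_iff : ∀ i j, a i j = 0 ↔ a j i = 0
  symmetrizable : ∀ i j, (d i : ℤ) * a i j = (d j : ℤ) * a j i
  d_pos : ∀ i, 0 < d i
  r_pos : ∀ i, 0 < r i
  null : ∀ j, ∑ i, (r i : ℤ) * (d i : ℤ) * a i j = 0

/-- The divided power `E_i^{(s)} = E_i^s/[s]_i!`. -/
def Ediv (a : Fin n → Fin n → ℤ) (d r : Fin n → ℕ) (i : Fin n) (s : ℕ) : Uq a d r :=
  (qfact d i s)⁻¹ • (gen a d r (Gen.E i)) ^ s

/-- The divided power `F_i^{(s)} = F_i^s/[s]_i!`. -/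
def Fdiv (a : Fin n → Fin n → ℤ) (d r : Fin n → ℕ) (i : Fin n) (s : ℕ) : Uq a d r :=
  (qfact d i s)⁻¹ • (gen a d r (Gen.F i)) ^ s

/-- The power `K_i^m` for an integer `m` (using `K_i⁻¹` for negative `m`). -/
def Kzpow (a : Fin n → Fin n → ℤ) (d r : Fin n → ℕ) (i : Fin n) (m : ℤ) : Uq a d r :=
  if 0 ≤ m then gen a d r (Gen.K i) ^ m.toNat else gen a d r (Gen.Kinv i) ^ (-m).toNat

/-- `T_i(E_j) = ∑_{s=0}^{-a_{ij}} (-1)^{s-a_{ij}} q_i^{-s} E_i^{(-a_{ij}-s)} E_j E_i^{(s)}`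
(for `j ≠ i`); note `(-1)^{s-a_{ij}} = (-1)^{s+(-a_{ij})}` as `a_{ij} ≤ 0`. -/
def TE (a : Fin n → Fin n → ℤ) (d r : Fin n → ℕ) (i j : Fin n) : Uq a d r :=
  ∑ s ∈ Finset.range ((-(a i j)).toNat + 1),
    ((-1 : Kq) ^ (s + (-(a i j)).toNat) * ((qi d i)⁻¹) ^ s) •
      (Ediv a d r i ((-(a i j)).toNat - s) * gen a d r (Gen.E j) * Ediv a d r i s)

/-- `T_i(F_j) = ∑_{s=0}^{-a_{ij}} (-1)^{s-a_{ij}} q_i^{s} F_i^{(s)} F_j F_i^{(-a_{ij}-s)}`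
(for `j ≠ i`). -/
def TF (a : Fin n → Fin n → ℤ) (d r : Fin n → ℕ) (i j : Fin n) : Uq a d r :=
  ∑ s ∈ Finset.range ((-(a i j)).toNat + 1),
    ((-1 : Kq) ^ (s + (-(a i j)).toNat) * (qi d i) ^ s) •
      (Fdiv a d r i s * gen a d r (Gen.F j) * Fdiv a d r i ((-(a i j)).toNat - s))

/-- `T_i⁻¹(E_j) = ∑_{s=0}^{-a_{ij}} (-1)^{s-a_{ij}} q_i^{-s} E_i^{(s)} E_j E_i^{(-a_{ij}-s)}`
(for `j ≠ i`). -/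
def TEinv (a : Fin n → Fin n → ℤ) (d r : Fin n → ℕ) (i j : Fin n) : Uq a d r :=
  ∑ s ∈ Finset.range ((-(a i j)).toNat + 1),
    ((-1 : Kq) ^ (s + (-(a i j)).toNat) * ((qi d i)⁻¹) ^ s) •
      (Ediv a d r i s * gen a d r (Gen.E j) * Ediv a d r i ((-(a i j)).toNat - s))

/-- `T_i⁻¹(F_j) = ∑_{s=0}^{-a_{ij}} (-1)^{s-a_{ij}} q_i^{s} F_i^{(-a_{ij}-s)} F_j F_i^{(s)}`
(for `j ≠ i`). -/
def TFinv (a : Fin n → Fin n → ℤ) (d r : Fin n → ℕ) (i j : Fin n) : Uq a d r :=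
  ∑ s ∈ Finset.range ((-(a i j)).toNat + 1),
    ((-1 : Kq) ^ (s + (-(a i j)).toNat) * (qi d i) ^ s) •
      (Fdiv a d r i ((-(a i j)).toNat - s) * gen a d r (Gen.F j) * Fdiv a d r i s)

/-- The defining conditions on Lusztig's braid group operator `T_i`. -/
def TCond (a : Fin n → Fin n → ℤ) (d r : Fin n → ℕ) (i : Fin n)
    (T : Uq a d r ≃ₐ[Kq] Uq a d r) : Prop :=
  T (gen a d r (Gen.E i)) = -(gen a d r (Gen.F i) * gen a d r (Gen.K i)) ∧
  T (gen a d r (Gen.F i)) = -(gen a d r (Gen.Kinv i) * gen a d r (Gen.E i)) ∧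
  (∀ j, T (gen a d r (Gen.K j)) = gen a d r (Gen.K j) * Kzpow a d r i (-(a i j))) ∧
  T (gen a d r Gen.g) = gen a d r Gen.g ∧
  (∀ j, j ≠ i → T (gen a d r (Gen.E j)) = TE a d r i j) ∧
  (∀ j, j ≠ i → T (gen a d r (Gen.F j)) = TF a d r i j)

/-- The stated values of the inverse braid group operator `T_i⁻¹`. -/
def TInvCond (a : Fin n → Fin n → ℤ) (d r : Fin n → ℕ) (i : Fin n)
    (Tinv : Uq a d r ≃ₐ[Kq] Uq a d r) : Prop :=
  Tinv (gen a d r (Gen.E i)) = -(gen a d r (Gen.Kinv i) * gen a d r (Gen.F i)) ∧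
  Tinv (gen a d r (Gen.F i)) = -(gen a d r (Gen.E i) * gen a d r (Gen.K i)) ∧
  (∀ j, Tinv (gen a d r (Gen.K j)) = gen a d r (Gen.K j) * Kzpow a d r i (-(a i j))) ∧
  Tinv (gen a d r Gen.g) = gen a d r Gen.g ∧
  (∀ j, j ≠ i → Tinv (gen a d r (Gen.E j)) = TEinv a d r i j) ∧
  (∀ j, j ≠ i → Tinv (gen a d r (Gen.F j)) = TFinv a d r i j)

/-- The pairing `(β, α_i) = ∑_j β_j d_i a_{ij}` for `β ∈ ℤ^Î`. -/
def wtpair (a : Fin n → Fin n → ℤ) (d : Fin n → ℕ) (β : Fin n → ℤ) (i : Fin n) : ℤ :=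
  ∑ j, β j * (d i : ℤ) * a i j

/-- `x ∈ U_q` has weight `β` if `K_j x K_j⁻¹ = q^{(β,α_j)} x` for all `j`, phrased
multiplicatively as `K_j x = q^{(β,α_j)} (x K_j)`. -/
def HasWeight (a : Fin n → Fin n → ℤ) (d r : Fin n → ℕ) (β : Fin n → ℤ)
    (x : Uq a d r) : Prop :=
  ∀ j, gen a d r (Gen.K j) * x = (qvar ^ wtpair a d β j) • (x * gen a d r (Gen.K j))

/-- The subalgebra `U⁺` of `U_q` generated by the `E_i`. -/
def Uplus (a : Fin n → Fin n → ℤ) (d r : Fin n → ℕ) : Subalgebra Kq (Uq a d r) :=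
  Algebra.adjoin Kq (Set.range fun i => gen a d r (Gen.E i))

lemma E_mem_Uplus (a : Fin n → Fin n → ℤ) (d r : Fin n → ℕ) (j : Fin n) :
    gen a d r (Gen.E j) ∈ Uplus a d r :=
  Algebra.subset_adjoin ⟨j, rfl⟩

/-- The generator `E_j` as an element of `U⁺`. -/
def Eplus (a : Fin n → Fin n → ℤ) (d r : Fin n → ℕ) (j : Fin n) : Uplus a d r :=
  ⟨gen a d r (Gen.E j), E_mem_Uplus a d r j⟩

/-- The defining properties of the twisted derivations `r_i : U⁺ → U⁺`:
`r_i(1) = 0`, `r_i(E_j) = δ_{ij}`, and the twisted Leibniz rule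
`r_i(xy) = q^{(|y|,α_i)} r_i(x) y + x r_i(y)` for weight-homogeneous `y`. -/
def DerProp (a : Fin n → Fin n → ℤ) (d r : Fin n → ℕ)
    (ri : Fin n → ((Uplus a d r) →ₗ[Kq] (Uplus a d r))) : Prop :=
  ∀ i : Fin n,
    ri i 1 = 0 ∧
    (∀ j, ri i (Eplus a d r j) = if i = j then 1 else 0) ∧
    (∀ (x y : Uplus a d r) (β : Fin n → ℤ), HasWeight a d r β (y : Uq a d r) →
      ri i (x * y) = (qvar ^ wtpair a d β i) • (ri i x * y) + x * ri i y)

/-- The span of the nonempty monomials `E_{j_1} ⋯ E_{j_m}`, `m ≥ 1` (elements of `U⁺`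
with zero constant term). -/
def AugSpan (a : Fin n → Fin n → ℤ) (d r : Fin n → ℕ) : Submodule Kq (Uq a d r) :=
  Submodule.span Kq
    {z | ∃ l : List (Fin n), l ≠ [] ∧ z = (l.map fun j => gen a d r (Gen.E j)).prod}

section Scalars

theorem qvar_ne_zero : qvar ≠ 0 := RatFunc.X_ne_zero

theorem qvar_pow_ne_C {m : ℕ} (hm : 0 < m) (c : ℚ) : qvar ^ m ≠ RatFunc.C c := by
  intro h
  rw [qvar, ← RatFunc.algebraMap_X, ← RatFunc.algebraMap_C, ← map_pow] at h
  have h' := congrArg Polynomial.natDegree (RatFunc.algebraMap_injective ℚ h)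
  rw [Polynomial.natDegree_X_pow, Polynomial.natDegree_C] at h'
  omega

theorem qvar_pow_ne_one {m : ℕ} (hm : 0 < m) : qvar ^ m ≠ 1 := by
  simpa using qvar_pow_ne_C hm 1

theorem qvar_zpow_ne_one {m : ℤ} (hm : m ≠ 0) : qvar ^ m ≠ 1 := by
  obtain ⟨k, rfl | rfl⟩ := m.eq_nat_or_neg
  · rw [zpow_natCast]
    exact qvar_pow_ne_one (by omega)
  · rw [zpow_neg, zpow_natCast, ne_eq, inv_eq_one]
    exact qvar_pow_ne_one (by omega)

variable (d : Fin n → ℕ) (i : Fin n)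

theorem qi_ne_zero : qi d i ≠ 0 := pow_ne_zero _ qvar_ne_zero

variable {d} {i}

theorem qi_zpow_ne_one (hd : 0 < d i) {m : ℤ} (hm : m ≠ 0) : qi d i ^ m ≠ 1 := by
  rw [qi, ← zpow_natCast, ← zpow_mul]
  exact qvar_zpow_ne_one (by positivity)

theorem qi_pow_ne_one (hd : 0 < d i) {m : ℕ} (hm : m ≠ 0) : qi d i ^ m ≠ 1 := by
  simpa using qi_zpow_ne_one hd (m := m) (by exact_mod_cast hm)

theorem qi_sub_inv_ne_zero (hd : 0 < d i) : qi d i - (qi d i)⁻¹ ≠ 0 := by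
  intro h
  have h0 := qi_ne_zero d i
  refine qi_pow_ne_one hd two_ne_zero ?_
  field_simp at h
  linear_combination h

theorem qint_ne_zero (hd : 0 < d i) {m : ℕ} (hm : m ≠ 0) : qint d i m ≠ 0 := by
  refine div_ne_zero (fun h => ?_) (qi_sub_inv_ne_zero hd)
  refine qi_pow_ne_one hd (m := 2 * m) (by omega) ?_
  have h0 := qi_ne_zero d i
  rw [zpow_neg, zpow_natCast] at h
  field_simp at h
  rw [mul_comm 2 m]
  linear_combination h

theorem qfact_ne_zero (hd : 0 < d i) (m : ℕ) : qfact d i m ≠ 0 := by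
  induction m with
  | zero => exact one_ne_zero
  | succ m ih =>
    rw [qfact]
    exact mul_ne_zero ih (by exact_mod_cast qint_ne_zero hd m.succ_ne_zero)

theorem qint_add (s t : ℕ) :
    (qi d i ^ s)⁻¹ * qint d i t + qi d i ^ t * qint d i s = qint d i ((t + s : ℕ) : ℤ) := by
  have h0 := qi_ne_zero d i
  simp only [qint, zpow_neg, zpow_natCast, pow_add]
  rw [mul_div_assoc', mul_div_assoc', ← add_div]
  congr 1
  field_simp
  ring

end Scalars

section BraidSequence

variable {k A : Type*} [Field k] [Ring A] [Algebra k A]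

/-- The iterated twisted commutators `y₀ = x`, `y_{t+1} = e y_t - p Q^t y_t e`. -/
def braidSeq (p Q : k) (e x : A) : ℕ → A
  | 0 => x
  | t + 1 => e * braidSeq p Q e x t - (p * Q ^ t) • (braidSeq p Q e x t * e)

theorem map_braidSeq {B : Type*} [Ring B] [Algebra k B] (φ : A →ₐ[k] B) (p Q : k) (e x : A)
    (t : ℕ) : φ (braidSeq p Q e x t) = braidSeq p Q (φ e) (φ x) t := by
  induction t with
  | zero => rfl
  | succ t ih => simp only [braidSeq, map_sub, map_mul, map_smul, ih]

theorem braidSeq_eq_zero_of_le {p Q : k} {e x : A} {s t : ℕ} (hst : s ≤ t)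
    (hs : braidSeq p Q e x s = 0) : braidSeq p Q e x t = 0 := by
  induction t, hst using Nat.le_induction with
  | base => exact hs
  | succ t _ ih => simp [braidSeq, ih]

theorem mul_braidSeq {p Q : k} {e x K : A} (hKe : K * e = Q • (e * K))
    (hKx : K * x = p • (x * K)) (t : ℕ) :
    K * braidSeq p Q e x t = (p * Q ^ t) • (braidSeq p Q e x t * K) := by
  induction t with
  | zero => simpa [braidSeq] using hKx
  | succ t ih =>
    have h₁ : K * (e * braidSeq p Q e x t) =
        (p * Q ^ (t + 1)) • (e * braidSeq p Q e x t * K) := by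
      rw [← mul_assoc, hKe, smul_mul_assoc, mul_assoc, ih, mul_smul_comm, smul_smul, mul_assoc]
      congr 1
      ring
    have h₂ : K * (braidSeq p Q e x t * e) =
        (p * Q ^ (t + 1)) • (braidSeq p Q e x t * e * K) := by
      rw [← mul_assoc, ih, smul_mul_assoc, mul_assoc, hKe, mul_smul_comm, smul_smul, ← mul_assoc]
      congr 1
      ring
    rw [braidSeq, mul_sub, mul_smul_comm, h₁, h₂, sub_mul, smul_mul_assoc]
    module

theorem braidSeq_commutator {p Q b : k} {e f x K K' : A} (hQ : Q ≠ 1) (hK : K * K' = 1)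
    (hK' : K' * K = 1) (hKe : K * e = Q • (e * K)) (hKx : K * x = p • (x * K))
    (hef : e * f - f * e = b • (K - K')) (hxf : x * f = f * x) (t : ℕ) :
    braidSeq p Q e x (t + 1) * f - f * braidSeq p Q e x (t + 1) =
      (b * (p ^ 2 * Q ^ t - 1) * ((Q ^ (t + 1) - 1) / (Q - 1))) •
        (K' * braidSeq p Q e x t) := by
  have hQ' : Q - 1 ≠ 0 := sub_ne_zero.mpr hQ
  have flip {z : A} {c : k} (h : K * z = c • (z * K)) : z * K' = c • (K' * z) := by
    calc z * K' = K' * (K * z) * K' := by rw [← mul_assoc, hK', one_mul]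
      _ = c • (K' * z) := by rw [h, mul_smul_comm, smul_mul_assoc, mul_assoc, mul_assoc, hK,
        mul_one]
  have key (t : ℕ) : braidSeq p Q e x (t + 1) * f - f * braidSeq p Q e x (t + 1) =
      e * (braidSeq p Q e x t * f - f * braidSeq p Q e x t)
        - (p * Q ^ t) • ((braidSeq p Q e x t * f - f * braidSeq p Q e x t) * e)
        - (b * (1 - p ^ 2 * Q ^ (2 * t))) • (K' * braidSeq p Q e x t) := by
    rw [braidSeq]
    have h₁ := mul_braidSeq hKe hKx t
    have h₂ := flip h₁
    generalize braidSeq p Q e x t = y at *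
    have h₄ : (e * f - f * e) * y = b • ((p * Q ^ t) • (y * K) - K' * y) := by
      rw [hef, smul_mul_assoc, sub_mul, h₁]
    have h₅ : y * (e * f - f * e) = b • (y * K - (p * Q ^ t) • (K' * y)) := by
      rw [hef, mul_smul_comm, mul_sub, h₂]
    calc _ = e * (y * f - f * y) + (e * f - f * e) * y
        - (p * Q ^ t) • ((y * f - f * y) * e + y * (e * f - f * e)) := by
          simp only [mul_sub, sub_mul, smul_mul_assoc, mul_smul_comm, mul_assoc]
          module
      _ = _ := by
          rw [h₄, h₅]
          match_scalars <;> ring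
  induction t with
  | zero =>
    rw [key]
    simp only [braidSeq, hxf, sub_self, mul_zero, zero_mul, smul_zero, zero_sub, ← neg_smul]
    congr 1
    field_simp
    ring
  | succ t ih =>
    rw [key, ih]
    have h := flip hKe
    have h' : e * (K' * braidSeq p Q e x t) = Q • (K' * braidSeq p Q e x (t + 1)) +
        (p * Q ^ (t + 1)) • (K' * braidSeq p Q e x t * e) := by
      rw [← mul_assoc, h, braidSeq, mul_sub, mul_smul_comm, smul_mul_assoc, mul_assoc, mul_assoc]
      module
    rw [mul_smul_comm, h', smul_mul_assoc]
    generalize braidSeq p Q e x (t + 1) = y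
    match_scalars
    · field_simp
      ring
    · ring

theorem braidSeq_commutator_base {p Q b : k} {e g x H H' : A} (hge : g * e = e * g)
    (hH : e * H = p • (H * e)) (hH' : H' * e = p • (e * H'))
    (hxg : x * g - g * x = b • (H' - H)) (t : ℕ) :
    braidSeq p Q e x (t + 1) * g - g * braidSeq p Q e x (t + 1) =
      (b * ∏ s ∈ Finset.range (t + 1), (1 - p ^ 2 * Q ^ s)) • (e ^ (t + 1) * H') := by
  have key (t : ℕ) : braidSeq p Q e x (t + 1) * g - g * braidSeq p Q e x (t + 1) =
      e * (braidSeq p Q e x t * g - g * braidSeq p Q e x t)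
        - (p * Q ^ t) • ((braidSeq p Q e x t * g - g * braidSeq p Q e x t) * e) := by
    have h₁ (z : A) : g * (e * z) = e * (g * z) := by rw [← mul_assoc, hge, mul_assoc]
    simp only [braidSeq, mul_sub, sub_mul, smul_mul_assoc, mul_smul_comm, mul_assoc, h₁, hge]
    module
  induction t with
  | zero =>
    rw [key]
    simp only [braidSeq]
    rw [hxg, mul_smul_comm, smul_mul_assoc, mul_sub, sub_mul, hH, hH']
    simp only [zero_add, Finset.range_one, Finset.prod_singleton, pow_one, pow_zero]
    module
  | succ t ih =>
    have h₁ : e * (e ^ (t + 1) * H') = e ^ (t + 1 + 1) * H' := by rw [← mul_assoc, ← pow_succ']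
    have h₂ : e ^ (t + 1) * H' * e = p • (e ^ (t + 1 + 1) * H') := by
      rw [mul_assoc, hH', mul_smul_comm, ← mul_assoc, ← pow_succ]
    rw [key, ih, Finset.prod_range_succ _ (t + 1), mul_smul_comm, smul_mul_assoc, h₁, h₂]
    module

theorem braidSeq_eq_sum {d : Fin n → ℕ} {i : Fin n} (hd : 0 < d i) [Algebra Kq A] (p : Kq)
    (e x : A) (t : ℕ) :
    braidSeq p (qi d i ^ 2) e x t = ∑ s ∈ Finset.range (t + 1),
      ((-1 : Kq) ^ s * qbinom d i t s * (p * qi d i ^ t * (qi d i)⁻¹) ^ s) •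
        (e ^ (t - s) * x * e ^ s) := by
  have h0 := qi_ne_zero d i
  have hf := qfact_ne_zero (d := d) hd
  set D : ℕ → ℕ → A := fun u s => ((qfact d i u)⁻¹ * (qfact d i s)⁻¹) • (e ^ u * x * e ^ s)
    with hD
  have hleft (u s : ℕ) : e * D u s = qint d i ((u + 1 : ℕ) : ℤ) • D (u + 1) s := by
    have := hf (u + 1)
    rw [qfact] at this
    simp only [hD, mul_smul_comm, ← mul_assoc, ← pow_succ', smul_smul, qfact]
    congr 1
    push_cast
    field_simp [right_ne_zero_of_mul this]
  have hright (u s : ℕ) : D u s * e = qint d i ((s + 1 : ℕ) : ℤ) • D u (s + 1) := by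
    have := hf (s + 1)
    rw [qfact] at this
    simp only [hD, smul_mul_assoc, mul_assoc, ← pow_succ, smul_smul, qfact]
    congr 1
    push_cast
    field_simp [right_ne_zero_of_mul this]
  have hzero : qint d i ((0 : ℕ) : ℤ) = 0 := by simp [qint]
  clear_value D
  have main (t : ℕ) : braidSeq p (qi d i ^ 2) e x t = qfact d i t •
      ∑ m ∈ Finset.HasAntidiagonal.antidiagonal t,
        ((-1 : Kq) ^ m.2 * (p * qi d i ^ t * (qi d i)⁻¹) ^ m.2) • D m.1 m.2 := by
    induction t with
    | zero => simp [braidSeq, qfact, hD]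
    | succ t ih =>
      have h₁ : e * ∑ m ∈ Finset.HasAntidiagonal.antidiagonal t,
          ((-1 : Kq) ^ m.2 * (p * qi d i ^ t * (qi d i)⁻¹) ^ m.2) • D m.1 m.2 =
          ∑ m ∈ Finset.HasAntidiagonal.antidiagonal (t + 1),
            ((-1 : Kq) ^ m.2 * (p * qi d i ^ t * (qi d i)⁻¹) ^ m.2 * qint d i (m.1 : ℤ)) •
              D m.1 m.2 := by
        rw [Finset.Nat.sum_antidiagonal_succ, Finset.mul_sum, hzero, mul_zero, zero_smul, zero_add]
        exact Finset.sum_congr rfl fun m _ => by rw [mul_smul_comm, hleft, smul_smul]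
      have h₂ : (∑ m ∈ Finset.HasAntidiagonal.antidiagonal t,
          ((-1 : Kq) ^ m.2 * (p * qi d i ^ t * (qi d i)⁻¹) ^ m.2) • D m.1 m.2) * e =
          ∑ m ∈ Finset.HasAntidiagonal.antidiagonal (t + 1),
            ((-1 : Kq) ^ (m.2 - 1) * (p * qi d i ^ t * (qi d i)⁻¹) ^ (m.2 - 1) *
              qint d i (m.2 : ℤ)) • D m.1 m.2 := by
        rw [Finset.Nat.sum_antidiagonal_succ', Finset.sum_mul, hzero, mul_zero, zero_smul, zero_add]
        exact Finset.sum_congr rfl fun m _ => by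
          rw [smul_mul_assoc, hright, smul_smul, Nat.add_sub_cancel]
      rw [braidSeq, ih, mul_smul_comm, smul_mul_assoc, h₁, h₂, qfact, mul_smul (qfact d i t),
        smul_comm (p * _) (qfact d i t), ← smul_sub]
      congr 1
      rw [Finset.smul_sum, Finset.smul_sum, ← Finset.sum_sub_distrib]
      refine Finset.sum_congr rfl fun m hm => ?_
      obtain ⟨u, s⟩ := m
      rw [Finset.HasAntidiagonal.mem_antidiagonal] at hm
      have hadd := qint_add (d := d) (i := i) s u
      rw [show u + s = t + 1 from hm] at hadd
      push_cast at hadd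
      simp only [smul_smul]
      rw [← sub_smul, ← hadd]
      congr 1
      cases s with
      | zero => simp [qint]
      | succ s =>
        simp only [Nat.add_sub_cancel]
        obtain rfl : t = u + s := by simp only at hm; omega
        obtain ⟨w, hw⟩ : ∃ w, w = p * qi d i ^ (u + s) * (qi d i)⁻¹ := ⟨_, rfl⟩
        have hw₁ : p * (qi d i ^ 2) ^ (u + s) = w * qi d i * qi d i ^ (u + s) := by
          rw [hw]
          field_simp
          ring
        have hw₂ : p * qi d i ^ (u + s + 1) * (qi d i)⁻¹ = w * qi d i := by
          rw [hw]
          field_simp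
          ring
        rw [hw₁, hw₂, ← hw, mul_pow]
        field_simp
        ring
  rw [main, ← Finset.Nat.sum_antidiagonal_swap, Finset.Nat.sum_antidiagonal_eq_sum_range_succ_mk,
    Finset.smul_sum]
  refine Finset.sum_congr rfl fun s _ => ?_
  simp only [hD, smul_smul, qbinom, Prod.fst_swap, Prod.snd_swap]
  congr 1
  field_simp

theorem sum_serre_eq_braidSeq {a : Fin n → Fin n → ℤ} {d : Fin n → ℕ} {i j : Fin n}
    (hd : 0 < d i) (ha : a i j ≤ 0) [Algebra Kq A] (e x : A) :
    ∑ s ∈ Finset.range ((1 - a i j).toNat + 1),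
      ((-1 : Kq) ^ s * qbinom d i (1 - a i j).toNat s) •
        (e ^ ((1 - a i j).toNat - s) * x * e ^ s) =
    braidSeq (qi d i ^ a i j) (qi d i ^ 2) e x (1 - a i j).toNat := by
  rw [braidSeq_eq_sum hd]
  have h : qi d i ^ a i j * qi d i ^ (1 - a i j).toNat * (qi d i)⁻¹ = 1 := by
    have h0 := qi_ne_zero d i
    rw [← zpow_natCast, Int.toNat_of_nonneg (by omega), ← zpow_neg_one, ← zpow_add₀ h0,
      ← zpow_add₀ h0]
    ring_nf
    simp
  simp [h]

theorem sum_braid_eq_braidSeq {a : Fin n → Fin n → ℤ} {d : Fin n → ℕ} {i j : Fin n}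
    (hd : 0 < d i) (ha : a i j ≤ 0) [Algebra Kq A] (e x : A) :
    ∑ s ∈ Finset.range ((-(a i j)).toNat + 1),
      ((-1 : Kq) ^ (s + (-(a i j)).toNat) * ((qi d i)⁻¹) ^ s) •
        ((qfact d i ((-(a i j)).toNat - s))⁻¹ • e ^ ((-(a i j)).toNat - s) * x *
          (qfact d i s)⁻¹ • e ^ s) =
    ((-1 : Kq) ^ (-(a i j)).toNat * (qfact d i (-(a i j)).toNat)⁻¹) •
      braidSeq (qi d i ^ a i j) (qi d i ^ 2) e x (-(a i j)).toNat := by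
  rw [braidSeq_eq_sum hd, Finset.smul_sum]
  have h : qi d i ^ a i j * qi d i ^ (-(a i j)).toNat * (qi d i)⁻¹ = (qi d i)⁻¹ := by
    have h0 := qi_ne_zero d i
    rw [← zpow_natCast, Int.toNat_of_nonneg (by omega), ← zpow_add₀ h0]
    simp
  rw [h]
  have hf := qfact_ne_zero (d := d) hd
  refine Finset.sum_congr rfl fun s _ => ?_
  simp only [smul_mul_assoc, mul_smul_comm, smul_smul, qbinom]
  congr 1
  have := hf (-(a i j)).toNat
  rw [pow_add]
  field_simp

end BraidSequence

section Relations

variable (a : Fin n → Fin n → ℤ) (d r : Fin n → ℕ)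

theorem gen_K_mul_Kinv (i : Fin n) : gen a d r (Gen.K i) * gen a d r (Gen.Kinv i) = 1 := by
  simpa [gen] using RingQuot.mkAlgHom_rel Kq (QRel.KKinv (a := a) (d := d) (r := r) i)

theorem gen_Kinv_mul_K (i : Fin n) : gen a d r (Gen.Kinv i) * gen a d r (Gen.K i) = 1 := by
  simpa [gen] using RingQuot.mkAlgHom_rel Kq (QRel.KinvK (a := a) (d := d) (r := r) i)

theorem gen_K_mul_E (i j : Fin n) : gen a d r (Gen.K i) * gen a d r (Gen.E j) =
    (qi d i ^ a i j) • (gen a d r (Gen.E j) * gen a d r (Gen.K i)) := by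
  simpa [gen] using RingQuot.mkAlgHom_rel Kq (QRel.KE (a := a) (d := d) (r := r) i j)

theorem gen_E_mul_F (i j : Fin n) : gen a d r (Gen.E i) * gen a d r (Gen.F j) -
    gen a d r (Gen.F j) * gen a d r (Gen.E i) =
      if i = j then (qi d i - (qi d i)⁻¹)⁻¹ • (gen a d r (Gen.K i) - gen a d r (Gen.Kinv i))
      else 0 := by
  have h := RingQuot.mkAlgHom_rel Kq (QRel.EF (a := a) (d := d) (r := r) i j)
  split_ifs at h ⊢ with hij
  · simpa [gen, hij] using h
  · simpa [gen, hij] using h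

variable {a d r}

theorem map_serreE (hC : CartanData n a d r) {A : Type*} [Ring A] [Algebra Kq A]
    (φ : FA n →ₐ[Kq] A) {i j : Fin n} (hij : i ≠ j) :
    φ (serreE a d i j) = braidSeq (qi d i ^ a i j) (qi d i ^ 2) (φ (ι (Gen.E i)))
      (φ (ι (Gen.E j))) (1 - a i j).toNat := by
  rw [← sum_serre_eq_braidSeq (hC.d_pos i) (hC.offdiag i j hij)]
  simp [serreE]

theorem map_serreF (hC : CartanData n a d r) {A : Type*} [Ring A] [Algebra Kq A]
    (φ : FA n →ₐ[Kq] A) {i j : Fin n} (hij : i ≠ j) :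
    φ (serreF a d i j) = braidSeq (qi d i ^ a i j) (qi d i ^ 2) (φ (ι (Gen.F i)))
      (φ (ι (Gen.F j))) (1 - a i j).toNat := by
  rw [← sum_serre_eq_braidSeq (hC.d_pos i) (hC.offdiag i j hij)]
  simp [serreF]

theorem serre_gen_E (hC : CartanData n a d r) {i j : Fin n} (hij : i ≠ j) :
    braidSeq (qi d i ^ a i j) (qi d i ^ 2) (gen a d r (Gen.E i)) (gen a d r (Gen.E j))
      (1 - a i j).toNat = 0 := by
  rw [gen, gen, ← map_serreE hC _ hij]
  simpa using RingQuot.mkAlgHom_rel Kq (QRel.serreEE (a := a) (d := d) (r := r) i j hij)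

theorem TE_eq_braidSeq (hC : CartanData n a d r) {i j : Fin n} (hij : i ≠ j) :
    TE a d r i j = ((-1 : Kq) ^ (-(a i j)).toNat * (qfact d i (-(a i j)).toNat)⁻¹) •
      braidSeq (qi d i ^ a i j) (qi d i ^ 2) (gen a d r (Gen.E i)) (gen a d r (Gen.E j))
        (-(a i j)).toNat := by
  rw [← sum_braid_eq_braidSeq (hC.d_pos i) (hC.offdiag i j hij)]
  rfl

end Relations

section Conjugation

/-- Conjugation `x ↦ u x v` by a unit `u` with inverse `v`. -/
def conjAlgHom {k A : Type*} [CommRing k] [Ring A] [Algebra k A] (u v : A) (huv : u * v = 1)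
    (hvu : v * u = 1) : A →ₐ[k] A where
  toFun x := u * x * v
  map_one' := by simp [huv]
  map_mul' x y := by
    calc u * (x * y) * v = u * x * (1 * (y * v)) := by simp only [mul_assoc, one_mul]
      _ = u * x * v * (u * y * v) := by simp only [← hvu, mul_assoc]
  map_zero' := by simp
  map_add' x y := by simp [mul_add, add_mul]
  commutes' c := by rw [← Algebra.commutes, mul_assoc, huv, mul_one]

variable (a : Fin n → Fin n → ℤ) (d r : Fin n → ℕ)

theorem gen_Kinv_mul_E (i j : Fin n) : gen a d r (Gen.Kinv i) * gen a d r (Gen.E j) =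
    (qi d i ^ a i j)⁻¹ • (gen a d r (Gen.E j) * gen a d r (Gen.Kinv i)) := by
  have hq : qi d i ^ a i j ≠ 0 := zpow_ne_zero _ (qi_ne_zero d i)
  have h : gen a d r (Gen.E j) * gen a d r (Gen.Kinv i) =
      (qi d i ^ a i j) • (gen a d r (Gen.Kinv i) * gen a d r (Gen.E j)) := by
    calc _ = gen a d r (Gen.Kinv i) * (gen a d r (Gen.K i) * gen a d r (Gen.E j)) *
        gen a d r (Gen.Kinv i) := by rw [← mul_assoc, gen_Kinv_mul_K, one_mul]
      _ = _ := by
        rw [gen_K_mul_E, mul_smul_comm, smul_mul_assoc, mul_assoc, mul_assoc, gen_K_mul_Kinv,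
          mul_one]
  rw [h, smul_smul, inv_mul_cancel₀ hq, one_smul]

theorem Uplus_le_comap_of_gen {B : Type*} [Ring B] [Algebra Kq B] (φ : Uq a d r →ₐ[Kq] B)
    (S : Subalgebra Kq B) (h : ∀ j, φ (gen a d r (Gen.E j)) ∈ S) : Uplus a d r ≤ S.comap φ := by
  refine Algebra.adjoin_le ?_
  rintro _ ⟨j, rfl⟩
  exact h j

/-- Conjugation `x ↦ u x v` on `U⁺` by a unit `u` of `U_q` with inverse `v`. -/
def conjUplus (u v : Uq a d r) (huv : u * v = 1) (hvu : v * u = 1)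
    (h : ∀ j, u * gen a d r (Gen.E j) * v ∈ Uplus a d r) : Uplus a d r →ₐ[Kq] Uplus a d r :=
  ((conjAlgHom u v huv hvu).comp (Uplus a d r).val).codRestrict (Uplus a d r) fun x =>
    Uplus_le_comap_of_gen a d r (conjAlgHom u v huv hvu) (Uplus a d r) h x.2

/-- Conjugation by `K_i` on `U⁺`. -/
def KConj (i : Fin n) : Uplus a d r →ₐ[Kq] Uplus a d r :=
  conjUplus a d r (gen a d r (Gen.K i)) (gen a d r (Gen.Kinv i)) (gen_K_mul_Kinv a d r i)
    (gen_Kinv_mul_K a d r i) fun j => by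
      rw [gen_K_mul_E, smul_mul_assoc, mul_assoc, gen_K_mul_Kinv, mul_one]
      exact Subalgebra.smul_mem _ (E_mem_Uplus a d r j) _

/-- Conjugation by `K_i⁻¹` on `U⁺`. -/
def KinvConj (i : Fin n) : Uplus a d r →ₐ[Kq] Uplus a d r :=
  conjUplus a d r (gen a d r (Gen.Kinv i)) (gen a d r (Gen.K i)) (gen_Kinv_mul_K a d r i)
    (gen_K_mul_Kinv a d r i) fun j => by
      rw [gen_Kinv_mul_E, smul_mul_assoc, mul_assoc, gen_Kinv_mul_K, mul_one]
      exact Subalgebra.smul_mem _ (E_mem_Uplus a d r j) _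

variable {a d r}

theorem coe_KConj (i : Fin n) (x : Uplus a d r) : (KConj a d r i x : Uq a d r) =
    gen a d r (Gen.K i) * x * gen a d r (Gen.Kinv i) := rfl

theorem coe_KinvConj (i : Fin n) (x : Uplus a d r) : (KinvConj a d r i x : Uq a d r) =
    gen a d r (Gen.Kinv i) * x * gen a d r (Gen.K i) := rfl

theorem KConj_mul_K (i : Fin n) (x : Uplus a d r) :
    (KConj a d r i x : Uq a d r) * gen a d r (Gen.K i) = gen a d r (Gen.K i) * x := by
  rw [coe_KConj, mul_assoc, gen_Kinv_mul_K, mul_one]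

theorem KConj_Eplus (i j : Fin n) :
    KConj a d r i (Eplus a d r j) = (qi d i ^ a i j) • Eplus a d r j := by
  apply Subtype.ext
  change gen a d r (Gen.K i) * gen a d r (Gen.E j) * gen a d r (Gen.Kinv i) =
    (qi d i ^ a i j) • gen a d r (Gen.E j)
  rw [gen_K_mul_E, smul_mul_assoc, mul_assoc, gen_K_mul_Kinv, mul_one]

theorem KinvConj_Eplus (i j : Fin n) :
    KinvConj a d r i (Eplus a d r j) = (qi d i ^ a i j)⁻¹ • Eplus a d r j := by
  apply Subtype.ext
  change gen a d r (Gen.Kinv i) * gen a d r (Gen.E j) * gen a d r (Gen.K i) =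
    (qi d i ^ a i j)⁻¹ • gen a d r (Gen.E j)
  rw [gen_Kinv_mul_E, smul_mul_assoc, mul_assoc, gen_Kinv_mul_K, mul_one]

theorem KConj_KinvConj (i : Fin n) (x : Uplus a d r) :
    KConj a d r i (KinvConj a d r i x) = x := by
  apply Subtype.ext
  simp only [coe_KConj, coe_KinvConj]
  calc _ = (gen a d r (Gen.K i) * gen a d r (Gen.Kinv i)) * x *
      (gen a d r (Gen.K i) * gen a d r (Gen.Kinv i)) := by simp only [mul_assoc]
    _ = x := by rw [gen_K_mul_Kinv, one_mul, mul_one]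

theorem KinvConj_KConj (i : Fin n) (x : Uplus a d r) :
    KinvConj a d r i (KConj a d r i x) = x := by
  apply Subtype.ext
  simp only [coe_KConj, coe_KinvConj]
  calc _ = (gen a d r (Gen.Kinv i) * gen a d r (Gen.K i)) * x *
      (gen a d r (Gen.Kinv i) * gen a d r (Gen.K i)) := by simp only [mul_assoc]
    _ = x := by rw [gen_Kinv_mul_K, one_mul, mul_one]

/-- A submodule of `U⁺` that contains `1` and is stable under left multiplication by the `E_j`
is everything. -/
theorem Uplus_left_induction (M : Submodule Kq (Uplus a d r)) (h1 : 1 ∈ M)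
    (hE : ∀ j, ∀ y ∈ M, Eplus a d r j * y ∈ M) (x : Uplus a d r) : x ∈ M := by
  have key : ∀ u : Uq a d r, ∀ hu : u ∈ Uplus a d r, ∀ y ∈ M,
      (⟨u, hu⟩ : Uplus a d r) * y ∈ M := by
    intro u hu
    induction hu using Algebra.adjoin_induction with
    | mem u hu =>
      obtain ⟨j, rfl⟩ := hu
      exact hE j
    | algebraMap c =>
      intro y hy
      have : (⟨algebraMap Kq _ c, (Uplus a d r).algebraMap_mem c⟩ : Uplus a d r) * y = c • y :=
        (Algebra.smul_def c y).symm
      rw [this]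
      exact M.smul_mem c hy
    | add u v hu hv ihu ihv =>
      intro y hy
      have := M.add_mem (ihu y hy) (ihv y hy)
      rwa [← add_mul] at this
    | mul u v hu hv ihu ihv =>
      intro y hy
      have := ihu _ (ihv y hy)
      rwa [← mul_assoc] at this
  simpa using key x.1 x.2 1 h1

end Conjugation

section Derivations

variable {a : Fin n → Fin n → ℤ} {d r : Fin n → ℕ}
  {ri : Fin n → ((Uplus a d r) →ₗ[Kq] (Uplus a d r))}

theorem wtpair_single (a : Fin n → Fin n → ℤ) (d : Fin n → ℕ) (i k : Fin n) :
    wtpair a d (Pi.single k 1) i = (d i : ℤ) * a i k := by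
  rw [wtpair, Finset.sum_eq_single k]
  · simp
  · intro j _ hj
    simp [hj]
  · simp

theorem qvar_zpow_wtpair_single (a : Fin n → Fin n → ℤ) (d : Fin n → ℕ) (i k : Fin n) :
    qvar ^ wtpair a d (Pi.single k 1) i = qi d i ^ a i k := by
  rw [wtpair_single, qi, zpow_mul, zpow_natCast]

theorem hasWeight_E (k : Fin n) : HasWeight a d r (Pi.single k 1) (gen a d r (Gen.E k)) := by
  intro j
  rw [qvar_zpow_wtpair_single, gen_K_mul_E]

theorem DerProp.map_mul (hri : DerProp a d r ri) (i : Fin n) (x y : Uplus a d r) :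
    ri i (x * y) = ri i x * KConj a d r i y + x * ri i y := by
  obtain ⟨y, hy⟩ := y
  induction hy using Algebra.adjoin_induction generalizing x with
  | mem y hy =>
    obtain ⟨k, rfl⟩ := hy
    have h := (hri i).2.2 x (Eplus a d r k) _ (hasWeight_E k)
    rw [qvar_zpow_wtpair_single] at h
    change ri i (x * Eplus a d r k) =
      ri i x * KConj a d r i (Eplus a d r k) + x * ri i (Eplus a d r k)
    rw [h, KConj_Eplus, mul_smul_comm]
  | algebraMap c =>
    change ri i (x * algebraMap Kq (Uplus a d r) c) =
      ri i x * KConj a d r i (algebraMap Kq (Uplus a d r) c) +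
        x * ri i (algebraMap Kq (Uplus a d r) c)
    rw [AlgHom.commutes, ← Algebra.commutes, ← Algebra.commutes, ← Algebra.smul_def,
      ← Algebra.smul_def, map_smul, Algebra.algebraMap_eq_smul_one, map_smul, (hri i).1,
      smul_zero, mul_zero, add_zero]
  | add u v hu hv ihu ihv =>
    have hu' := ihu x
    have hv' := ihv x
    change ri i (x * (⟨u, hu⟩ + ⟨v, hv⟩)) =
      ri i x * KConj a d r i (⟨u, hu⟩ + ⟨v, hv⟩) + x * ri i (⟨u, hu⟩ + ⟨v, hv⟩)
    rw [mul_add, map_add, hu', hv', map_add, map_add, mul_add, mul_add]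
    abel
  | mul u v hu hv ihu ihv =>
    change ri i (x * (⟨u, hu⟩ * ⟨v, hv⟩)) =
      ri i x * KConj a d r i (⟨u, hu⟩ * ⟨v, hv⟩) + x * ri i (⟨u, hu⟩ * ⟨v, hv⟩)
    rw [← mul_assoc, ihv, ihu, ihv, _root_.map_mul, add_mul, mul_add]
    simp only [mul_assoc, add_assoc]

theorem DerProp.map_E_mul (hri : DerProp a d r ri) (i k : Fin n) (y : Uplus a d r) :
    ri i (Eplus a d r k * y) =
      (if i = k then KConj a d r i y else 0) + Eplus a d r k * ri i y := by
  rw [hri.map_mul, (hri i).2.1]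
  split_ifs <;> simp

/-- The opposite twisted derivation, normalised by conjugation with `K_i⁻¹`. -/
theorem DerProp.exists_opposite (hri : DerProp a d r ri) (hd : ∀ i, 0 < d i) (i : Fin n) :
    ∃ s : Uplus a d r →ₗ[Kq] Uplus a d r, s 1 = 0 ∧ ∀ k y, s (Eplus a d r k * y) =
      (if i = k then KinvConj a d r i y else 0) + Eplus a d r k * s y := by
  let c := qi d i - (qi d i)⁻¹
  have hc : c ≠ 0 := qi_sub_inv_ne_zero (hd i)
  let K := gen a d r (Gen.K i)
  let K' := gen a d r (Gen.Kinv i)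
  let F := gen a d r (Gen.F i)
  have hK' : K' * K = 1 := gen_Kinv_mul_K a d r i
  let S : Uplus a d r →ₗ[Kq] Uq a d r :=
    LinearMap.mulRight Kq (K * K) ∘ₗ (Uplus a d r).val.toLinearMap ∘ₗ ri i -
      c • (LinearMap.mulRight Kq K ∘ₗ (LinearMap.mulRight Kq F - LinearMap.mulLeft Kq F) ∘ₗ
        (Uplus a d r).val.toLinearMap)
  have hS (x : Uplus a d r) : S x = ri i x * (K * K) - c • ((x * F - F * x) * K) := rfl
  have hS1 : S 1 = 0 := by simp [hS, (hri i).1]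
  have hSE (k : Fin n) (y : Uplus a d r) : S (Eplus a d r k * y) =
      (if i = k then (KinvConj a d r i y : Uq a d r) else 0) + Eplus a d r k * S y := by
    have hEF : (Eplus a d r k : Uq a d r) * F - F * Eplus a d r k =
        if k = i then c⁻¹ • (K - K') else 0 := by
      rw [show (Eplus a d r k : Uq a d r) * F - F * Eplus a d r k = _ from gen_E_mul_F a d r k i]
      split_ifs with h
      · rw [h]
      · rfl
    have hsplit : (Eplus a d r k : Uq a d r) * y * F - F * (Eplus a d r k * y) =
        Eplus a d r k * (y * F - F * y) +
          ((Eplus a d r k : Uq a d r) * F - F * Eplus a d r k) * y := by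
      simp only [mul_sub, sub_mul, mul_assoc]
      abel
    rw [hS, hS, hri.map_E_mul]
    push_cast
    rw [hsplit, hEF]
    generalize (y : Uq a d r) * F - F * y = w
    by_cases h : k = i
    · subst h
      simp only [if_true]
      have hz : (KConj a d r k y : Uq a d r) * (K * K) = K * y * K := by
        rw [← mul_assoc]
        exact congrArg (· * K) (KConj_mul_K k y)
      rw [add_mul, hz, add_mul, smul_add, smul_mul_assoc, smul_mul_assoc, smul_smul,
        mul_inv_cancel₀ hc, one_smul,
        show (KinvConj a d r k y : Uq a d r) = K' * y * K from rfl]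
      simp only [sub_mul, mul_sub, mul_assoc, mul_smul_comm]
      abel
    · simp only [h, Ne.symm h, if_false, ZeroMemClass.coe_zero, zero_add, zero_mul, add_zero,
        mul_sub, mul_smul_comm, mul_assoc]
  have hmem (x : Uplus a d r) : S x ∈ Subalgebra.toSubmodule (Uplus a d r) := by
    refine Uplus_left_induction ((Subalgebra.toSubmodule (Uplus a d r)).comap S) ?_ ?_ x
    · rw [Submodule.mem_comap, hS1]
      exact zero_mem _
    · intro j y hy
      rw [Submodule.mem_comap, hSE]
      refine add_mem ?_ ((Uplus a d r).mul_mem (E_mem_Uplus a d r j) hy)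
      split_ifs
      · exact (KinvConj a d r i y).2
      · exact zero_mem _
  refine ⟨S.codRestrict (Subalgebra.toSubmodule (Uplus a d r)) hmem, Subtype.ext hS1,
    fun k y => Subtype.ext ?_⟩
  change S (Eplus a d r k * y) = _
  rw [hSE]
  push_cast
  split_ifs <;> rfl

/-- The lowering operators of the lowest weight Verma module, realised on `U⁺`, on whose lowest
weight vector every `K_i` acts by `4`. -/
theorem DerProp.exists_lowering (hri : DerProp a d r ri) (hd : ∀ i, 0 < d i) (i : Fin n) :
    ∃ f : Uplus a d r →ₗ[Kq] Uplus a d r, f 1 = 0 ∧ ∀ k y, f (Eplus a d r k * y) =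
      Eplus a d r k * f y - (if k = i then (qi d i - (qi d i)⁻¹)⁻¹ •
        ((4 : Kq) • KConj a d r i y - (4 : Kq)⁻¹ • KinvConj a d r i y) else 0) := by
  have comb {V : Type} [AddCommGroup V] [Module Kq V] (b : Kq) (u v w z : V) :
      (-(b * 4)) • (u + v) + (b * 4⁻¹) • (w + z) =
        (-(b * 4)) • v + (b * 4⁻¹) • z - b • ((4 : Kq) • u - (4 : Kq)⁻¹ • w) := by
    simp only [smul_add, smul_sub, smul_smul, neg_smul]
    abel
  obtain ⟨s, hs1, hsE⟩ := hri.exists_opposite hd i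
  refine ⟨(-((qi d i - (qi d i)⁻¹)⁻¹ * 4)) • ri i + ((qi d i - (qi d i)⁻¹)⁻¹ * 4⁻¹) • s, ?_,
    fun k y => ?_⟩
  · simp [hs1, (hri i).1]
  · simp only [LinearMap.add_apply, LinearMap.smul_apply, hri.map_E_mul, hsE,
      mul_add, mul_smul_comm]
    by_cases h : k = i
    · subst h
      simp only [if_true]
      exact comb (V := Uplus a d r) _ _ _ _ _
    · simp only [h, Ne.symm h, if_false, zero_add]
      exact (sub_zero (G := Uplus a d r) _).symm

end Derivations

section LowestWeight

variable {a : Fin n → Fin n → ℤ} {d r : Fin n → ℕ}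

/-- An algebra homomorphism out of `U_q` is determined by operators satisfying the relations. -/
theorem exists_algHom_Uq {B : Type*} [Ring B] [Algebra Kq B] (v : Gen n → B)
    (h : ∀ x y, QRel a d r x y → FreeAlgebra.lift Kq v x = FreeAlgebra.lift Kq v y) :
    ∃ φ : Uq a d r →ₐ[Kq] B, ∀ x, φ (gen a d r x) = v x := by
  refine ⟨RingQuot.liftAlgHom Kq ⟨FreeAlgebra.lift Kq v, fun x y => h x y⟩, fun x => ?_⟩
  rw [gen, RingQuot.liftAlgHom_mkAlgHom_apply, ι, FreeAlgebra.lift_ι_apply]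

/-- The scalars by which `K_i` acts on the monomials in the `E_j`, on the level of a product of
operators. -/
theorem list_prod_mul_eq {B : Type*} [Ring B] [Algebra Kq B] {K : Fin n → B} {e : B}
    {p : Fin n → Kq} (h : ∀ i, K i * e = p i • (e * K i)) (l : List (Fin n)) :
    (l.map fun i => K i ^ r i).prod * e =
      (l.map fun i => p i ^ r i).prod • (e * (l.map fun i => K i ^ r i).prod) := by
  have hpow (i : Fin n) (m : ℕ) : K i ^ m * e = p i ^ m • (e * K i ^ m) := by
    induction m with
    | zero => simp
    | succ m ih =>
      rw [pow_succ, mul_assoc, h, mul_smul_comm, ← mul_assoc, ih, smul_mul_assoc, smul_smul,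
        mul_assoc, ← pow_succ, ← pow_succ', pow_succ (K i)]
  induction l with
  | nil => simp
  | cons i l ih =>
    simp only [List.map_cons, List.prod_cons]
    rw [mul_assoc, ih, mul_smul_comm, ← mul_assoc, hpow, smul_mul_assoc, smul_smul, mul_assoc,
      mul_comm (p i ^ r i)]

/-- The Verma-type representation of `U_q` whose lowest weight vector is scaled by `4` by all
the `K_i`, built on an algebra that behaves like `U⁺`. -/
theorem exists_lowestWeight_rep (hC : CartanData n a d r) {A : Type*} [Ring A] [Algebra Kq A]
    (e : Fin n → A) (kc ki : Fin n → A →ₐ[Kq] A) (f : Fin n → A →ₗ[Kq] A)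
    (hgen : ∀ M : Submodule Kq A, 1 ∈ M → (∀ j, ∀ y ∈ M, e j * y ∈ M) → ∀ x, x ∈ M)
    (hkc : ∀ i j, kc i (e j) = (qi d i ^ a i j) • e j)
    (hkcki : ∀ i x, kc i (ki i x) = x) (hkikc : ∀ i x, ki i (kc i x) = x)
    (hf1 : ∀ i, f i 1 = 0)
    (hfe : ∀ i k y, f i (e k * y) = e k * f i y - (if k = i then (qi d i - (qi d i)⁻¹)⁻¹ •
        ((4 : Kq) • kc i y - (4 : Kq)⁻¹ • ki i y) else 0))
    (hserre : ∀ i j, i ≠ j →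
      braidSeq (qi d i ^ a i j) (qi d i ^ 2) (e i) (e j) (1 - a i j).toNat = 0) :
    ∃ ρ : Uq a d r →ₐ[Kq] Module.End Kq A,
      (∀ j y, ρ (gen a d r (Gen.E j)) y = e j * y) ∧
      (∀ i y, ρ (gen a d r (Gen.Kinv i)) y = (4 : Kq)⁻¹ • ki i y) ∧
      (∀ i, ρ (gen a d r (Gen.F i)) = f i) := by
  have : CharZero Kq := algebraRat.charZero Kq
  have h4 : (4 : Kq) ≠ 0 := by norm_num
  have h2 : (2 : Kq) ≠ 0 := two_ne_zero
  obtain ⟨e', he'⟩ : ∃ e' : Fin n → Module.End Kq A, ∀ j, e' j = Algebra.lmul Kq A (e j) :=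
    ⟨_, fun _ => rfl⟩
  have he'y (j : Fin n) (y : A) : e' j y = e j * y := by rw [he']; rfl
  obtain ⟨K, hKy⟩ : ∃ K : Fin n → Module.End Kq A, ∀ i y, K i y = (4 : Kq) • kc i y :=
    ⟨fun i => (4 : Kq) • (kc i).toLinearMap, fun _ _ => rfl⟩
  obtain ⟨K', hK'y⟩ : ∃ K' : Fin n → Module.End Kq A, ∀ i y, K' i y = (4 : Kq)⁻¹ • ki i y :=
    ⟨fun i => (4 : Kq)⁻¹ • (ki i).toLinearMap, fun _ _ => rfl⟩
  obtain ⟨f', hf'⟩ : ∃ f' : Fin n → Module.End Kq A, ∀ i, f' i = f i := ⟨f, fun _ => rfl⟩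
  obtain ⟨b, hb⟩ : ∃ b : Fin n → Kq, ∀ i, b i = (qi d i - (qi d i)⁻¹)⁻¹ := ⟨_, fun _ => rfl⟩
  obtain ⟨c, hcdef⟩ : ∃ c : Kq, c = ∏ i, 2 ^ r i := ⟨_, rfl⟩
  have hc : c ≠ 0 := hcdef ▸ Finset.prod_ne_zero_iff.2 fun i _ => pow_ne_zero _ h2
  have hzero (X : Module.End Kq A) (h1 : X 1 = 0)
      (hX : ∀ j, ∃ p : Kq, X * e' j = p • (e' j * X)) : X = 0 := by
    refine LinearMap.ext fun x => hgen (LinearMap.ker X) h1 (fun j y hy => ?_) x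
    obtain ⟨p, hp⟩ := hX j
    have := LinearMap.congr_fun hp y
    simp only [Module.End.mul_apply, LinearMap.smul_apply, he'y] at this
    rw [LinearMap.mem_ker] at hy ⊢
    rw [this, hy, mul_zero, smul_zero]
  have hKK' (i : Fin n) : K i * K' i = 1 := by
    ext x
    rw [Module.End.mul_apply, hKy, hK'y, map_smul, hkcki, smul_smul, mul_inv_cancel₀ h4, one_smul,
      Module.End.one_apply]
  have hK'K (i : Fin n) : K' i * K i = 1 := by
    ext x
    rw [Module.End.mul_apply, hKy, hK'y, map_smul, hkikc, smul_smul, inv_mul_cancel₀ h4, one_smul,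
      Module.End.one_apply]
  have hKe (i j : Fin n) : K i * e' j = (qi d i ^ a i j) • (e' j * K i) := by
    ext x
    rw [LinearMap.smul_apply, Module.End.mul_apply, Module.End.mul_apply, hKy, hKy, he'y, he'y,
      map_mul, hkc, smul_mul_assoc, mul_smul_comm, smul_comm]
  have hK1 (i : Fin n) : K i 1 = (4 : Kq) • 1 := by
    rw [hKy, map_one]
  have hK (i j : Fin n) : K i * K j = K j * K i := by
    refine sub_eq_zero.1 (hzero _ ?_ fun k => ⟨qi d i ^ a i k * qi d j ^ a j k, ?_⟩)
    · simp [hK1]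
    · rw [sub_mul, mul_assoc, hKe, mul_smul_comm, ← mul_assoc, hKe, smul_mul_assoc, smul_smul,
        mul_assoc (K j), hKe i, mul_smul_comm, ← mul_assoc, hKe j, smul_mul_assoc, smul_smul,
        mul_sub, smul_sub, mul_assoc, mul_assoc, mul_comm (qi d j ^ a j k)]
  have hKK'comm (i j : Fin n) : K i * K' j = K' j * K i :=
    calc K i * K' j = K' j * (K j * K i) * K' j := by rw [← mul_assoc, hK'K, one_mul]
      _ = K' j * K i := by rw [hK j i, mul_assoc, mul_assoc, hKK', mul_one]
  have hef (k i : Fin n) : e' k * f' i - f' i * e' k =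
      if k = i then b i • (K i - K' i) else 0 := by
    ext x
    rw [LinearMap.sub_apply, Module.End.mul_apply, Module.End.mul_apply, hf', he'y, he'y, hfe,
      sub_sub_cancel]
    split_ifs
    · rw [LinearMap.smul_apply, LinearMap.sub_apply, hKy, hK'y, hb]
    · rfl
  have hfe' (i k : Fin n) : f' i * e' k =
      e' k * f' i - if k = i then b i • (K i - K' i) else 0 := by
    rw [← hef, sub_sub_cancel]
  have hfe'' (i : Fin n) : f' i * e' i - e' i * f' i = b i • (K' i - K i) := by
    have h := hef i i
    rw [if_pos rfl] at h
    rw [← neg_sub, h, ← neg_sub (K i)]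
    exact (smul_neg (b i) (K i - K' i)).symm
  have hf'1 (i : Fin n) : f' i 1 = 0 := by rw [hf', hf1]
  have hKf (i j : Fin n) : K i * f' j = (qi d i ^ (-(a i j))) • (f' j * K i) := by
    refine sub_eq_zero.1 (hzero _ ?_ fun k => ⟨qi d i ^ a i k, ?_⟩)
    · simp [hK1, hf'1]
    · have hp : qi d i ^ (-(a i j)) * qi d i ^ a i j = 1 := by
        rw [← zpow_add₀ (qi_ne_zero d i), neg_add_cancel, zpow_zero]
      have h1 : K i * f' j * e' k = (qi d i ^ a i k) • (e' k * (K i * f' j)) -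
          if k = j then b j • (K i * K j - K i * K' j) else 0 := by
        rw [mul_assoc, hfe', mul_sub, ← mul_assoc, hKe, smul_mul_assoc, mul_assoc]
        split_ifs <;> simp [mul_sub]
      have h2 : f' j * K i * e' k = (qi d i ^ a i k) • (e' k * (f' j * K i) -
          if k = j then b j • (K i * K j - K i * K' j) else 0) := by
        rw [mul_assoc, hKe, mul_smul_comm, ← mul_assoc, hfe', sub_mul, mul_assoc]
        split_ifs <;> simp [sub_mul, hK i j, hKK'comm i j]
      rw [sub_mul, smul_mul_assoc, h1, h2, mul_sub, mul_smul_comm]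
      split_ifs with h
      · subst h
        generalize b k • (K i * K k - K i * K' k) = w
        rw [smul_sub (qi d i ^ a i k), smul_sub (qi d i ^ (-(a i k))), smul_sub (qi d i ^ a i k),
          smul_smul, smul_smul, smul_smul, mul_comm (qi d i ^ a i k), hp, one_smul, one_smul]
        abel
      · rw [sub_zero, sub_zero, smul_sub, smul_smul, smul_smul, mul_comm]
  have hK'f (i j : Fin n) : K' i * f' j = (qi d i ^ a i j) • (f' j * K' i) := by
    have h : f' j * K' i = (qi d i ^ (-(a i j))) • (K' i * f' j) :=
      calc f' j * K' i = K' i * (K i * f' j) * K' i := by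
            rw [← mul_assoc, hK'K, one_mul]
        _ = _ := by rw [hKf, mul_smul_comm, smul_mul_assoc, mul_assoc, mul_assoc, hKK', mul_one]
    rw [h, smul_smul, ← zpow_add₀ (qi_ne_zero d i), add_neg_cancel, zpow_zero, one_smul]
  have hserreF (i j : Fin n) (hij : i ≠ j) :
      braidSeq (qi d i ^ a i j) (qi d i ^ 2) (f' i) (f' j) (1 - a i j).toNat = 0 := by
    have ha := hC.offdiag i j hij
    obtain ⟨t, ht⟩ : ∃ t : ℕ, a i j = -t := ⟨(-(a i j)).toNat, by omega⟩
    have htt : (1 - a i j).toNat = t + 1 := by omega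
    rw [htt]
    have hpt : (qi d i ^ a i j) ^ 2 * (qi d i ^ 2) ^ t = 1 := by
      rw [ht, zpow_neg, zpow_natCast, inv_pow, ← pow_mul, ← pow_mul, mul_comm t 2,
        inv_mul_cancel₀ (pow_ne_zero _ (qi_ne_zero d i))]
    refine hzero _ ?_ fun k => ⟨1, ?_⟩
    · have (s : ℕ) : braidSeq (qi d i ^ a i j) (qi d i ^ 2) (f' i) (f' j) s 1 = 0 := by
        induction s with
        | zero => exact hf'1 j
        | succ s ih => simp [braidSeq, ih, hf'1]
      exact this _
    · rw [one_smul, ← sub_eq_zero]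
      have hfe0 {i k : Fin n} (h : k ≠ i) : f' i * e' k = e' k * f' i := by
        rw [hfe', if_neg h, sub_zero]
      by_cases hki : k = i
      · subst hki
        rw [braidSeq_commutator (K := K' k) (K' := K k) (b := b k)
          (qi_pow_ne_one (hC.d_pos k) two_ne_zero) (hK'K k) (hKK' k) ?_ (hK'f k j) ?_
          (hfe0 hij), hpt]
        · simp
        · rw [hK'f, hC.diag]
          rfl
        · exact hfe'' k
      · by_cases hkj : k = j
        · subst hkj
          have hs : qi d i ^ a i k = qi d k ^ a k i := by
            have := hC.symmetrizable i k
            simp only [qi, ← zpow_natCast, ← zpow_mul, this]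
          rw [braidSeq_commutator_base (H := K k) (H' := K' k) (b := b k) (hfe0 hki).symm ?_ ?_ ?_]
          · rw [Finset.prod_eq_zero (Finset.self_mem_range_succ t), mul_zero, zero_smul]
            rw [hpt, sub_self]
          · rw [hKf, hs, smul_smul, ← zpow_add₀ (qi_ne_zero d k), add_neg_cancel, zpow_zero,
              one_smul]
          · rw [hK'f, hs]
          · exact hfe'' k
        · rw [sub_eq_zero]
          generalize t + 1 = s
          induction s with
          | zero => exact hfe0 hkj
          | succ s ih =>
            have hl : f' i * braidSeq (qi d i ^ a i j) (qi d i ^ 2) (f' i) (f' j) s * e' k =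
                e' k * (f' i * braidSeq (qi d i ^ a i j) (qi d i ^ 2) (f' i) (f' j) s) := by
              rw [mul_assoc, ih, ← mul_assoc, hfe0 hki, mul_assoc]
            have hr : braidSeq (qi d i ^ a i j) (qi d i ^ 2) (f' i) (f' j) s * f' i * e' k =
                e' k * (braidSeq (qi d i ^ a i j) (qi d i ^ 2) (f' i) (f' j) s * f' i) := by
              rw [mul_assoc, hfe0 hki, ← mul_assoc, ih, mul_assoc]
            rw [braidSeq, sub_mul, mul_sub, smul_mul_assoc, mul_smul_comm, hl, hr]
  have hgsq : ((List.finRange n).map fun i => K i ^ r i).prod = (c * c) • 1 := by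
    refine sub_eq_zero.1 (hzero _ ?_ fun k => ⟨1, ?_⟩)
    · have hpow (i : Fin n) (m : ℕ) : (K i ^ m) 1 = (4 : Kq) ^ m • 1 := by
        induction m with
        | zero => simp
        | succ m ih =>
          rw [pow_succ, Module.End.mul_apply, hK1, map_smul, ih, smul_smul, pow_succ']
      have hl (l : List (Fin n)) : (l.map fun i => K i ^ r i).prod 1 =
          (l.map fun i => (4 : Kq) ^ r i).prod • (1 : A) := by
        induction l with
        | nil => simp
        | cons i l ih =>
          rw [List.map_cons, List.prod_cons, Module.End.mul_apply, ih, map_smul, hpow, smul_smul,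
            List.map_cons, List.prod_cons, mul_comm]
      have hcc : c * c = ∏ i, (4 : Kq) ^ r i := by
        rw [hcdef, ← Finset.prod_mul_distrib]
        refine Finset.prod_congr rfl fun i _ => ?_
        rw [← mul_pow]
        norm_num
      rw [LinearMap.sub_apply, hl, hcc, Fin.prod_univ_def, LinearMap.smul_apply]
      exact sub_self _
    · have h1 : ((List.finRange n).map fun i => (qi d i ^ a i k) ^ r i).prod = 1 := by
        rw [← Fin.prod_univ_def]
        simp only [qi, ← zpow_natCast, ← zpow_mul]
        rw [← zpow_zero qvar, ← hC.null k]
        have (s : Finset (Fin n)) (w : Fin n → ℤ) : ∏ i ∈ s, qvar ^ w i = qvar ^ ∑ i ∈ s, w i := by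
          induction s using Finset.cons_induction with
          | empty => simp
          | cons i s hi ih =>
            rw [Finset.prod_cons, Finset.sum_cons, zpow_add₀ qvar_ne_zero, ih]
        rw [this]
        congr 1
        exact Finset.sum_congr rfl fun i _ => by ring
      rw [sub_mul, mul_sub, list_prod_mul_eq fun i => hKe i k, h1, one_smul, one_smul,
        smul_mul_assoc, one_mul, mul_smul_comm, mul_one]
  let v : Gen n → Module.End Kq A
    | Gen.E j => e' j
    | Gen.F j => f' j
    | Gen.K j => K j
    | Gen.Kinv j => K' j
    | Gen.g => c • 1
    | Gen.ginv => c⁻¹ • 1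
  have hv (x : Gen n) : FreeAlgebra.lift Kq v (ι x) = v x := FreeAlgebra.lift_ι_apply v x
  obtain ⟨ρ, hρ⟩ := exists_algHom_Uq (a := a) (d := d) (r := r) v fun x y hxy => by
    induction hxy with
    | KKinv i => simp only [map_mul, map_one, hv]; exact hKK' i
    | KinvK i => simp only [map_mul, map_one, hv]; exact hK'K i
    | gginv =>
      simp only [map_mul, map_one, hv]
      change c • 1 * c⁻¹ • 1 = (1 : Module.End Kq A)
      rw [smul_mul_smul_comm, mul_inv_cancel₀ hc, one_smul, one_mul]
    | ginvg =>
      simp only [map_mul, map_one, hv]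
      change c⁻¹ • 1 * c • 1 = (1 : Module.End Kq A)
      rw [smul_mul_smul_comm, inv_mul_cancel₀ hc, one_smul, one_mul]
    | gcomm x =>
      simp only [map_mul, hv]
      change c • 1 * v x = v x * c • 1
      rw [smul_mul_assoc, one_mul, mul_smul_comm, mul_one]
    | gsq =>
      rw [map_mul, map_list_prod, List.map_map]
      simp only [Function.comp_def, map_pow, hv]
      change c • 1 * c • 1 = ((List.finRange n).map fun i => K i ^ r i).prod
      rw [hgsq, smul_mul_smul_comm, one_mul]
    | KK i j => simp only [map_mul, hv]; exact hK i j
    | KE i j => simp only [map_mul, map_smul, hv]; exact hKe i j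
    | KF i j => simp only [map_mul, map_smul, hv]; exact hKf i j
    | EF i j =>
      have h := hef i j
      split_ifs at h ⊢ with hij
      · subst hij
        simp only [map_mul, map_smul, map_sub, hv]
        rw [← hb]
        exact h
      · simp only [map_mul, map_sub, map_zero, hv]
        exact h
    | serreEE i j hij =>
      rw [map_serreE hC _ hij, hv, hv, map_zero]
      change braidSeq _ _ (e' i) (e' j) _ = 0
      rw [he', he', ← map_braidSeq, hserre i j hij, map_zero]
    | serreFF i j hij =>
      rw [map_serreF hC _ hij, hv, hv, map_zero]
      exact hserreF i j hij
  refine ⟨ρ, fun j y => ?_, fun i y => ?_, fun i => ?_⟩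
  · rw [hρ]
    exact he'y j y
  · rw [hρ]
    exact hK'y i y
  · rw [hρ]
    exact hf' i

end LowestWeight

section SkewExpansion

variable {k A : Type*} [Field k] [Ring A] [Algebra k A]

theorem map_braidSeq_of_eigen (κ : A →ₐ[k] A) {p Q : k} {e x : A} (he : κ e = Q • e)
    (hx : κ x = p • x) (t : ℕ) : κ (braidSeq p Q e x t) = (p * Q ^ t) • braidSeq p Q e x t := by
  induction t with
  | zero => simpa [braidSeq] using hx
  | succ t ih =>
    simp only [braidSeq, map_sub, map_smul, map_mul, he, ih, smul_sub, smul_mul_smul_comm,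
      smul_smul]
    congr 2 <;> ring

theorem skewDerivation_braidSeq {δ : A →ₗ[k] A} {κ : A →ₐ[k] A}
    (hδ : ∀ x y, δ (x * y) = δ x * κ y + x * δ y) {p Q : k} {e x : A} (he : κ e = Q • e)
    (hx : κ x = p • x) (hδe : δ e = 1) (hδx : δ x = 0) (t : ℕ) :
    δ (braidSeq p Q e x t) = 0 := by
  induction t with
  | zero => exact hδx
  | succ t ih =>
    rw [braidSeq, map_sub, map_smul, hδ, hδ, ih, hδe, map_braidSeq_of_eigen κ he hx]
    simp

theorem skewDerivation_pow {δ : A →ₗ[k] A} {κ : A →ₐ[k] A}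
    (hδ : ∀ x y, δ (x * y) = δ x * κ y + x * δ y) {Q : k} {e : A} (he : κ e = Q • e)
    (hδe : δ e = 1) (m : ℕ) :
    δ (e ^ (m + 1)) = (∑ l ∈ Finset.range (m + 1), Q ^ l) • e ^ m := by
  induction m with
  | zero => simp [hδe]
  | succ m ih =>
    rw [pow_succ' e (m + 1), hδ, ih, hδe, map_pow, he, one_mul, smul_pow, mul_smul_comm,
      ← pow_succ', ← add_smul, Finset.sum_range_succ _ (m + 1), add_comm]

/-- In an expansion in powers of `e` with coefficients killed by a skew derivation, only the
constant term survives if the skew derivation kills the whole expansion. -/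
theorem coeff_eq_zero_of_skewDerivation {δ : A →ₗ[k] A} {κ : A →ₐ[k] A}
    (hδ : ∀ x y, δ (x * y) = δ x * κ y + x * δ y) {Q : k} {e : A} (he : κ e = Q • e)
    (hδe : δ e = 1) (hQ : ∀ m, ∑ l ∈ Finset.range (m + 1), Q ^ l ≠ 0) (N : ℕ)
    (c : ℕ → A) (hc : ∀ m, δ (c m) = 0)
    (h : δ (∑ m ∈ Finset.range (N + 1), c m * e ^ m) = 0) : ∀ m < N, c (m + 1) = 0 := by
  have hsum (N : ℕ) (c : ℕ → A) (hc : ∀ m, δ (c m) = 0) :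
      δ (∑ m ∈ Finset.range (N + 1), c m * e ^ m) = ∑ m ∈ Finset.range N,
        ((∑ l ∈ Finset.range (m + 1), Q ^ l) • c (m + 1)) * e ^ m := by
    rw [Finset.sum_range_succ', map_add, map_sum, pow_zero, mul_one, hc, add_zero]
    refine Finset.sum_congr rfl fun m _ => ?_
    rw [hδ, hc, zero_mul, zero_add, skewDerivation_pow hδ he hδe, mul_smul_comm, smul_mul_assoc]
  induction N generalizing c with
  | zero => simp
  | succ N ih =>
    set c' : ℕ → A := fun m => (∑ l ∈ Finset.range (m + 1), Q ^ l) • c (m + 1) with hc'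
    have hc'0 (m : ℕ) : δ (c' m) = 0 := by rw [hc', map_smul, hc, smul_zero]
    rw [hsum _ c hc] at h
    change ∑ m ∈ Finset.range (N + 1), c' m * e ^ m = 0 at h
    have hpos := ih c' hc'0 (by rw [h, map_zero])
    have hzero : ∀ m < N + 1, c' m = 0 := by
      have h0 : c' 0 = 0 := by
        rw [Finset.sum_range_succ', Finset.sum_eq_zero, zero_add, pow_zero, mul_one] at h
        · exact h
        · intro m hm
          rw [hpos m (Finset.mem_range.1 hm), zero_mul]
      intro m hm
      cases m with
      | zero => exact h0
      | succ m => exact hpos m (by omega)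
    exact fun m hm => (smul_eq_zero.1 (hzero m hm)).resolve_left (hQ m)

/-- If left multiplication by `e` is a skew polynomial rule over the subalgebra generated by
`S`, then every element has an expansion in powers of `e` with coefficients in that subalgebra. -/
theorem exists_skew_expansion (κ : A →ₐ[k] A) (e : A) (S : Set A)
    (hκ : ∀ s ∈ S, κ s ∈ Algebra.adjoin k S)
    (he : ∀ s ∈ S, e * s - κ s * e ∈ Algebra.adjoin k S)
    (hgen : ∀ M : Submodule k A, 1 ∈ M → (∀ y ∈ M, e * y ∈ M) →
      (∀ s ∈ S, ∀ y ∈ M, s * y ∈ M) → ∀ x, x ∈ M) (x : A) :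
    ∃ N : ℕ, ∃ c : ℕ → A, (∀ m, c m ∈ Algebra.adjoin k S) ∧
      x = ∑ m ∈ Finset.range (N + 1), c m * e ^ m := by
  set C := Algebra.adjoin k S
  have hκC (c : A) (hc : c ∈ C) : κ c ∈ C :=
    (Algebra.adjoin_le (fun s hs => hκ s hs) : C ≤ C.comap κ) hc
  have heC (c : A) (hc : c ∈ C) : e * c - κ c * e ∈ C := by
    induction hc using Algebra.adjoin_induction with
    | mem s hs => exact he s hs
    | algebraMap c =>
      rw [AlgHom.commutes, Algebra.commutes, sub_self]
      exact C.zero_mem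
    | add u v hu hv ihu ihv =>
      have : e * (u + v) - κ (u + v) * e = (e * u - κ u * e) + (e * v - κ v * e) := by
        rw [map_add, mul_add, add_mul]
        abel
      rw [this]
      exact C.add_mem ihu ihv
    | mul u v hu hv ihu ihv =>
      have : e * (u * v) - κ (u * v) * e = (e * u - κ u * e) * v + κ u * (e * v - κ v * e) := by
        simp only [map_mul, mul_sub, sub_mul, mul_assoc]
        abel
      rw [this]
      exact C.add_mem (C.mul_mem ihu hv) (C.mul_mem (hκC u hu) ihv)
  let L : (ℕ →₀ C) →ₗ[k] A :=
    Finsupp.lsum k fun m => LinearMap.mulRight k (e ^ m) ∘ₗ C.val.toLinearMap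
  have hL (m : ℕ) (c : C) : L (Finsupp.single m c) = c * e ^ m := by
    simp [L]
  have hmem (m : ℕ) (c : A) (hc : c ∈ C) : c * e ^ m ∈ LinearMap.range L :=
    ⟨Finsupp.single m ⟨c, hc⟩, hL _ _⟩
  have hstable (z : A) (hz : ∀ m, ∀ c ∈ C, z * (c * e ^ m) ∈ LinearMap.range L) :
      ∀ y ∈ LinearMap.range L, z * y ∈ LinearMap.range L := by
    rintro _ ⟨c, rfl⟩
    induction c using Finsupp.induction_linear with
    | zero => simp
    | add u v hu hv =>
      rw [map_add, mul_add]
      exact add_mem hu hv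
    | single m c =>
      rw [hL]
      exact hz m c c.2
  obtain ⟨c, rfl⟩ := hgen (LinearMap.range L)
    (by simpa using hmem 0 1 C.one_mem)
    (hstable e fun m c hc => by
      have : e * (c * e ^ m) = κ c * e ^ (m + 1) + (e * c - κ c * e) * e ^ m := by
        rw [pow_succ', sub_mul, mul_assoc, mul_assoc]
        abel
      rw [this]
      exact add_mem (hmem _ _ (hκC c hc)) (hmem _ _ (heC c hc)))
    (fun s hs => hstable s fun m c hc => by
      rw [← mul_assoc]
      exact hmem _ _ (C.mul_mem (Algebra.subset_adjoin hs) hc)) x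
  refine ⟨c.support.sup id, fun m => c m, fun m => (c m).2, ?_⟩
  have hLc : L c = c.sum fun m a => (a : A) * e ^ m := by
    simp only [L, Finsupp.lsum_apply]
    rfl
  rw [hLc]
  refine Finsupp.sum_of_support_subset _ (fun m hm => ?_) _ (by simp)
  exact Finset.mem_range.2 (Nat.lt_succ_of_le (Finset.le_sup (f := id) hm))

/-- The values of a lowering operator on the powers of the raising operator. -/
theorem lowering_pow {f : A →ₗ[k] A} {κ κ' : A →ₐ[k] A} {Q b c : k} {e : A} (hQ0 : Q ≠ 0)
    (hQ1 : Q ≠ 1) (hκ : κ e = Q • e) (hκ' : κ' e = Q⁻¹ • e) (hf1 : f 1 = 0)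
    (hf : ∀ y, f (e * y) = e * f y - b • (c • κ y - c⁻¹ • κ' y)) (m : ℕ) :
    f (e ^ (m + 1)) =
      (-(b * ((Q ^ (m + 1) - 1) / (Q - 1) * (c - c⁻¹ * (Q ^ m)⁻¹)))) • e ^ m := by
  have hQ1' : Q - 1 ≠ 0 := sub_ne_zero.2 hQ1
  have hrec (m : ℕ) : f (e ^ (m + 1)) =
      e * f (e ^ m) - (b * (c * Q ^ m - c⁻¹ * (Q ^ m)⁻¹)) • e ^ m := by
    rw [pow_succ', hf, map_pow κ, map_pow κ', hκ, hκ', smul_pow, smul_pow, smul_smul, smul_smul,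
      ← sub_smul, smul_smul, inv_pow]
  induction m with
  | zero =>
    rw [hrec, pow_zero, hf1]
    simp [div_self hQ1', neg_smul]
  | succ m ih =>
    rw [hrec, ih, mul_smul_comm, ← pow_succ', ← sub_smul]
    congr 1
    generalize c⁻¹ = c'
    field_simp
    ring

/-- Coefficients of a polynomial in a lowering operator acting trivially vanish. -/
theorem coeff_eq_zero_of_lowering {f : A →ₗ[k] A} {e : A} (hf1 : f 1 = 0)
    (hf : ∀ m, ∃ c : k, c ≠ 0 ∧ f (e ^ (m + 1)) = c • e ^ m) (N : ℕ) (u : ℕ → A)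
    (h : ∀ y, ∑ m ∈ Finset.range N, u m * (f ^ m) y = 0) : ∀ m < N, u m = 0 := by
  have htop (m : ℕ) : ∃ c : k, c ≠ 0 ∧ (f ^ m) (e ^ m) = c • 1 := by
    induction m with
    | zero => exact ⟨1, one_ne_zero, by simp⟩
    | succ m ih =>
      obtain ⟨c, hc, h⟩ := ih
      obtain ⟨c', hc', h'⟩ := hf m
      refine ⟨c' * c, mul_ne_zero hc' hc, ?_⟩
      rw [pow_succ f, Module.End.mul_apply, h', map_smul, h, smul_smul]
  have hover (m l : ℕ) (hl : m < l) : (f ^ l) (e ^ m) = 0 := by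
    obtain ⟨s, rfl⟩ := Nat.exists_eq_add_of_lt hl
    obtain ⟨c, -, h⟩ := htop m
    rw [show m + s + 1 = s + 1 + m by ring, pow_add, Module.End.mul_apply, h, map_smul, pow_succ,
      Module.End.mul_apply, hf1, map_zero, smul_zero]
  intro m
  induction m using Nat.strong_induction_on with
  | _ m ih =>
    intro hm
    have hy := h (e ^ m)
    rw [Finset.sum_eq_single_of_mem m (Finset.mem_range.2 hm)] at hy
    · obtain ⟨c, hc, h⟩ := htop m
      rw [h, mul_smul_comm, mul_one] at hy
      exact (smul_eq_zero.1 hy).resolve_left hc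
    · intro l hl hlm
      rcases lt_or_gt_of_ne hlm with hlt | hgt
      · rw [ih l hlt (Finset.mem_range.1 hl), zero_mul]
      · rw [hover m l hgt, mul_zero]

end SkewExpansion

section BraidOperator

variable {a : Fin n → Fin n → ℤ} {d r : Fin n → ℕ}
  {ri : Fin n → ((Uplus a d r) →ₗ[Kq] (Uplus a d r))}

theorem algHom_neg_apply {k A V : Type*} [CommRing k] [Ring A] [Algebra k A] [AddCommGroup V]
    [Module k V] (ρ : A →ₐ[k] Module.End k V) (x : A) (y : V) : ρ (-x) y = -(ρ x y) := by
  rw [map_neg, LinearMap.neg_apply]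

/-- A representation of `U_q` on `U⁺`, extending left multiplication, in which `K_i⁻¹F_i` lowers
the powers of `E_i` faithfully. -/
theorem DerProp.exists_lowering_rep (hri : DerProp a d r ri) (hC : CartanData n a d r)
    (i : Fin n) : ∃ ρ : Uq a d r →ₐ[Kq] Module.End Kq (Uplus a d r),
      (∀ u y : Uplus a d r, ρ u y = u * y) ∧
      ρ (-(gen a d r (Gen.Kinv i) * gen a d r (Gen.F i))) 1 = 0 ∧
      ∀ m, ∃ c : Kq, c ≠ 0 ∧ ρ (-(gen a d r (Gen.Kinv i) * gen a d r (Gen.F i)))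
        (Eplus a d r i ^ (m + 1)) = c • Eplus a d r i ^ m := by
  choose f hf1 hfe using fun i => hri.exists_lowering hC.d_pos i
  obtain ⟨ρ, hρE, hρK, hρF⟩ := exists_lowestWeight_rep hC (A := Uplus a d r) (Eplus a d r)
    (KConj a d r) (KinvConj a d r) f Uplus_left_induction KConj_Eplus KConj_KinvConj
    KinvConj_KConj hf1 hfe fun i j hij => Subtype.ext <| by
      have h := map_braidSeq (Uplus a d r).val (p := qi d i ^ a i j) (Q := qi d i ^ 2)
        (e := Eplus a d r i) (x := Eplus a d r j) (1 - a i j).toNat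
      exact h.trans (serre_gen_E hC hij)
  have hρu (u y : Uplus a d r) : ρ u y = u * y := by
    let M : Submodule Kq (Uplus a d r) :=
      { carrier := {u | ∀ y, ρ u y = u * y}
        add_mem' := fun {u v} hu hv y => by
          have : ρ ((u + v : Uplus a d r) : Uq a d r) y = ρ u y + ρ v y := by
            rw [AddMemClass.coe_add, map_add]
            rfl
          rw [this, hu, hv, add_mul]
        zero_mem' := fun y => by
          rw [ZeroMemClass.coe_zero, map_zero, zero_mul]
          rfl
        smul_mem' := fun c u hu y => by
          have : ρ ((c • u : Uplus a d r) : Uq a d r) y = c • ρ u y := by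
            rw [SetLike.val_smul, map_smul]
            rfl
          rw [this, hu, smul_mul_assoc] }
    refine Uplus_left_induction M (fun y => ?_) (fun j u hu y => ?_) u y
    · rw [OneMemClass.coe_one, map_one, one_mul]
      rfl
    · have : ρ ((Eplus a d r j * u : Uplus a d r) : Uq a d r) y =
          ρ (gen a d r (Gen.E j)) (ρ u y) := by
        rw [MulMemClass.coe_mul, _root_.map_mul]
        rfl
      rw [this, hρE, hu, mul_assoc]
  have hop (y : Uplus a d r) : ρ (-(gen a d r (Gen.Kinv i) * gen a d r (Gen.F i))) y =
      (-(4 : Kq)⁻¹) • KinvConj a d r i (f i y) := by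
    refine (algHom_neg_apply ρ _ y).trans ?_
    rw [_root_.map_mul, hρF, Module.End.mul_apply, hρK]
    exact (neg_smul (4 : Kq)⁻¹ (KinvConj a d r i (f i y))).symm
  have hQ0 : qi d i ^ 2 ≠ 0 := pow_ne_zero _ (qi_ne_zero d i)
  have hQ1 (m : ℕ) (hm : m ≠ 0) : (qi d i ^ 2) ^ m ≠ 1 := by
    rw [← pow_mul]
    exact qi_pow_ne_one (hC.d_pos i) (by omega)
  have hκ : KConj a d r i (Eplus a d r i) = qi d i ^ 2 • Eplus a d r i := by
    rw [KConj_Eplus, hC.diag]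
    rfl
  have hκ' : KinvConj a d r i (Eplus a d r i) = (qi d i ^ 2)⁻¹ • Eplus a d r i := by
    rw [KinvConj_Eplus, hC.diag]
    rfl
  have : CharZero Kq := algebraRat.charZero Kq
  have h4 : (4 : Kq) ≠ 0 := by norm_num
  refine ⟨ρ, hρu, ?_, fun m => ?_⟩
  · rw [hop, hf1, map_zero, smul_zero]
  · have hlow := lowering_pow (A := Uplus a d r) (f := f i) (c := 4) hQ0
      (by simpa using hQ1 1 one_ne_zero) hκ hκ' (hf1 i)
      (fun y => (hfe i i y).trans (by rw [if_pos rfl])) m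
    refine ⟨-(4 : Kq)⁻¹ * -((qi d i - (qi d i)⁻¹)⁻¹ * (((qi d i ^ 2) ^ (m + 1) - 1) /
      (qi d i ^ 2 - 1) * (4 - 4⁻¹ * ((qi d i ^ 2) ^ m)⁻¹))) * (qi d i ^ 2)⁻¹ ^ m, ?_, ?_⟩
    · have h16 : (4 : Kq) - 4⁻¹ * ((qi d i ^ 2) ^ m)⁻¹ ≠ 0 := by
        intro h
        have hm0 : (qi d i ^ 2) ^ m ≠ 0 := pow_ne_zero _ hQ0
        have h' : (qi d i ^ 2) ^ m = 16⁻¹ := by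
          field_simp at h ⊢
          linear_combination h
        rcases Nat.eq_zero_or_pos m with rfl | hm
        · norm_num at h'
        · rw [qi, ← pow_mul, ← pow_mul] at h'
          refine qvar_pow_ne_C (m := d i * (2 * m)) ?_ (16⁻¹) ?_
          · have := hC.d_pos i
            positivity
          · rw [h', map_inv₀, map_ofNat]
      have hb := qi_sub_inv_ne_zero (hC.d_pos i)
      have hm1 := sub_ne_zero.2 (hQ1 (m + 1) m.succ_ne_zero)
      have h1 := sub_ne_zero.2 (by simpa using hQ1 1 one_ne_zero : qi d i ^ 2 ≠ 1)
      exact mul_ne_zero (mul_ne_zero (neg_ne_zero.2 (inv_ne_zero h4)) (neg_ne_zero.2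
        (mul_ne_zero (inv_ne_zero hb) (mul_ne_zero (div_ne_zero hm1 h1) h16))))
        (pow_ne_zero _ (inv_ne_zero hQ0))
    · rw [hop, hlow, map_smul, map_pow, hκ', smul_pow, smul_smul, smul_smul]

theorem eq_neg_neg_mul_mul {A : Type*} [Ring A] {u v : A} (h : u * v = 1) (x : A) :
    x = -(-(x * u) * v) := by
  rw [neg_mul, neg_neg, mul_assoc, h, mul_one]

theorem eq_neg_mul_neg_mul {A : Type*} [Ring A] {u v : A} (h : u * v = 1) (x : A) :
    x = -(u * -(v * x)) := by
  rw [mul_neg, neg_neg, ← mul_assoc, h, one_mul]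

theorem mul_neg_sub_neg_mul {A : Type*} [Ring A] (x y : A) :
    x * -y - -y * x = y * x - x * y := by
  rw [mul_neg, neg_mul]
  abel

theorem TCond.symm_Kinv {i : Fin n} {T : Uq a d r ≃ₐ[Kq] Uq a d r} (hC : CartanData n a d r)
    (hT : TCond a d r i T) : T.symm (gen a d r (Gen.Kinv i)) = gen a d r (Gen.K i) := by
  rw [AlgEquiv.symm_apply_eq, hT.2.2.1, hC.diag, Kzpow, if_neg (by norm_num)]
  change _ = gen a d r (Gen.K i) * gen a d r (Gen.Kinv i) ^ 2
  rw [pow_two, ← mul_assoc, gen_K_mul_Kinv, one_mul]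

theorem TCond.map_Kinv {i : Fin n} {T : Uq a d r ≃ₐ[Kq] Uq a d r} (hC : CartanData n a d r)
    (hT : TCond a d r i T) : T (gen a d r (Gen.Kinv i)) = gen a d r (Gen.K i) := by
  have hK : T (gen a d r (Gen.K i)) = gen a d r (Gen.Kinv i) :=
    ((AlgEquiv.symm_apply_eq T).1 (hT.symm_Kinv hC)).symm
  have h : gen a d r (Gen.Kinv i) * T (gen a d r (Gen.Kinv i)) = 1 := by
    rw [← hK, ← map_mul, hK, gen_K_mul_Kinv, map_one]
  calc _ = gen a d r (Gen.K i) * (gen a d r (Gen.Kinv i) * T (gen a d r (Gen.Kinv i))) := by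
        rw [← mul_assoc, gen_K_mul_Kinv, one_mul]
    _ = _ := by rw [h, mul_one]

theorem TCond.symm_F {i : Fin n} {T : Uq a d r ≃ₐ[Kq] Uq a d r} (hC : CartanData n a d r)
    (hT : TCond a d r i T) : T.symm (gen a d r (Gen.F i)) =
      -(gen a d r (Gen.E i) * gen a d r (Gen.K i)) := by
  rw [AlgEquiv.symm_apply_eq, map_neg, map_mul, hT.1,
    ← (AlgEquiv.symm_apply_eq T).1 (hT.symm_Kinv hC)]
  exact eq_neg_neg_mul_mul (gen_K_mul_Kinv a d r i) _

theorem TCond.symm_E {i : Fin n} {T : Uq a d r ≃ₐ[Kq] Uq a d r} (hC : CartanData n a d r)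
    (hT : TCond a d r i T) : T.symm (gen a d r (Gen.E i)) =
      -(gen a d r (Gen.Kinv i) * gen a d r (Gen.F i)) := by
  rw [AlgEquiv.symm_apply_eq, map_neg, map_mul, hT.2.1, hT.map_Kinv hC]
  exact eq_neg_mul_neg_mul (gen_K_mul_Kinv a d r i) _

/-- `T_i⁻¹` maps the iterated skew commutators of `E_i` with `E_j` into `U⁺`. -/
theorem TCond.symm_braidSeq_mem {i j : Fin n} {T : Uq a d r ≃ₐ[Kq] Uq a d r}
    (hC : CartanData n a d r) (hT : TCond a d r i T) (hij : i ≠ j) (t : ℕ) :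
    T.symm (braidSeq (qi d i ^ a i j) (qi d i ^ 2) (gen a d r (Gen.E i)) (gen a d r (Gen.E j)) t) ∈
      Uplus a d r := by
  set y := braidSeq (qi d i ^ a i j) (qi d i ^ 2) (gen a d r (Gen.E i)) (gen a d r (Gen.E j))
    with hy
  have ha := hC.offdiag i j hij
  obtain ⟨m, hm⟩ : ∃ m : ℕ, a i j = -m := ⟨(-(a i j)).toNat, by omega⟩
  have htop : T.symm (y m) ∈ Uplus a d r := by
    have hTE := TE_eq_braidSeq (r := r) hC hij
    have hmm : (-(a i j)).toNat = m := by omega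
    rw [hmm] at hTE
    have hne : (-1 : Kq) ^ m * (qfact d i m)⁻¹ ≠ 0 :=
      mul_ne_zero (pow_ne_zero _ (neg_ne_zero.2 one_ne_zero))
        (inv_ne_zero (qfact_ne_zero (hC.d_pos i) m))
    have hsymm : T.symm (TE a d r i j) = gen a d r (Gen.E j) := by
      rw [AlgEquiv.symm_apply_eq, hT.2.2.2.2.1 j hij.symm]
    rw [hTE, map_smul] at hsymm
    have : T.symm (y m) = ((-1 : Kq) ^ m * (qfact d i m)⁻¹)⁻¹ • gen a d r (Gen.E j) := by
      rw [← hsymm, smul_smul, inv_mul_cancel₀ hne, one_smul]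
    rw [this]
    exact Subalgebra.smul_mem _ (E_mem_Uplus a d r j) _
  have hdown (t : ℕ) (ht : t < m) (h : T.symm (y (t + 1)) ∈ Uplus a d r) :
      T.symm (y t) ∈ Uplus a d r := by
    have hQ1 (m : ℕ) (hm : m ≠ 0) : (qi d i ^ 2) ^ m ≠ 1 := by
      rw [← pow_mul]
      exact qi_pow_ne_one (hC.d_pos i) (by omega)
    have hQ : qi d i ^ 2 ≠ 1 := by simpa using hQ1 1 one_ne_zero
    have hef := gen_E_mul_F a d r i i
    rw [if_pos rfl] at hef
    have hxf := gen_E_mul_F a d r j i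
    rw [if_neg hij.symm, sub_eq_zero] at hxf
    have hcomm := braidSeq_commutator hQ (gen_K_mul_Kinv a d r i) (gen_Kinv_mul_K a d r i)
      (by rw [gen_K_mul_E, hC.diag]; rfl) (gen_K_mul_E a d r i j) hef hxf t
    rw [← hy] at hcomm
    set κ : Kq := (qi d i - (qi d i)⁻¹)⁻¹ * ((qi d i ^ a i j) ^ 2 * (qi d i ^ 2) ^ t - 1) *
      (((qi d i ^ 2) ^ (t + 1) - 1) / (qi d i ^ 2 - 1)) with hκdef
    have hκ : κ ≠ 0 := by
      refine mul_ne_zero (mul_ne_zero (inv_ne_zero (qi_sub_inv_ne_zero (hC.d_pos i)))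
        (sub_ne_zero.2 ?_)) (div_ne_zero (sub_ne_zero.2 (hQ1 _ t.succ_ne_zero)) (sub_ne_zero.2 hQ))
      have : (qi d i ^ a i j) ^ 2 * (qi d i ^ 2) ^ t = qi d i ^ (2 * a i j + 2 * t) := by
        rw [zpow_add₀ (qi_ne_zero d i), mul_comm 2 (a i j), zpow_mul, zpow_mul]
        norm_cast
      rw [this]
      exact qi_zpow_ne_one (hC.d_pos i) (by omega)
    have hS := congrArg T.symm hcomm
    simp only [map_sub, map_mul, map_smul, hT.symm_F hC, hT.symm_Kinv hC] at hS
    obtain ⟨z, hz⟩ : ∃ z : Uplus a d r, (z : Uq a d r) = T.symm (y (t + 1)) := ⟨⟨_, h⟩, rfl⟩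
    rw [← hz] at hS
    have hy_eq : T.symm (y t) = κ⁻¹ • ((KinvConj a d r i (Eplus a d r i) * z : Uplus a d r) :
        Uq a d r) - κ⁻¹ • ((KinvConj a d r i (z * Eplus a d r i) : Uplus a d r) : Uq a d r) := by
      have h1 : gen a d r (Gen.K i) * T.symm (y t) = κ⁻¹ •
          (gen a d r (Gen.E i) * gen a d r (Gen.K i) * z -
            z * (gen a d r (Gen.E i) * gen a d r (Gen.K i))) := by
        have : gen a d r (Gen.E i) * gen a d r (Gen.K i) * z -
            z * (gen a d r (Gen.E i) * gen a d r (Gen.K i)) =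
              κ • (gen a d r (Gen.K i) * T.symm (y t)) := by
          rw [← hS]
          exact (mul_neg_sub_neg_mul _ _).symm
        rw [this, smul_smul, inv_mul_cancel₀ hκ, one_smul]
      have h2 : T.symm (y t) =
          gen a d r (Gen.Kinv i) * (gen a d r (Gen.K i) * T.symm (y t)) := by
        rw [← mul_assoc, gen_Kinv_mul_K, one_mul]
      rw [h2, h1, mul_smul_comm, mul_sub, smul_sub, MulMemClass.coe_mul, coe_KinvConj,
        coe_KinvConj, MulMemClass.coe_mul]
      simp only [mul_assoc]
      rfl
    rw [hy_eq]
    exact sub_mem (Subalgebra.smul_mem _ (SetLike.coe_mem _) _)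
      (Subalgebra.smul_mem _ (SetLike.coe_mem _) _)
  rcases le_or_gt t m with htm | htm
  · exact Nat.decreasingInduction' (fun t ht _ h => hdown t ht h) htm htop
  · have hz : y (m + 1) = 0 := by
      have := serre_gen_E (r := r) hC hij
      rwa [show (1 - a i j).toNat = m + 1 by omega] at this
    rw [hy, braidSeq_eq_zero_of_le (Nat.succ_le_of_lt htm) hz, map_zero]
    exact zero_mem _

end BraidOperator

section Kernel

variable {a : Fin n → Fin n → ℤ} {d r : Fin n → ℕ}

/-- Every element of `U⁺` is a polynomial in `E_i` whose coefficients lie in the subalgebra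
generated by the iterated skew commutators of `E_i` with the `E_j`, `j ≠ i`. -/
theorem exists_Eplus_expansion (hC : CartanData n a d r) (i : Fin n) (x : Uplus a d r) :
    ∃ N : ℕ, ∃ c : ℕ → Uplus a d r,
      (∀ m, c m ∈ Algebra.adjoin Kq {y : Uplus a d r | ∃ j t, i ≠ j ∧
        y = braidSeq (qi d i ^ a i j) (qi d i ^ 2) (Eplus a d r i) (Eplus a d r j) t}) ∧
      x = ∑ m ∈ Finset.range (N + 1), c m * Eplus a d r i ^ m := by
  have he : KConj a d r i (Eplus a d r i) = qi d i ^ 2 • Eplus a d r i := by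
    rw [KConj_Eplus, hC.diag]
    rfl
  have hκ (j : Fin n) (t : ℕ) := map_braidSeq_of_eigen (A := Uplus a d r) (KConj a d r i)
    (p := qi d i ^ a i j) (x := Eplus a d r j) he (KConj_Eplus i j) t
  refine exists_skew_expansion (KConj a d r i) _ _ ?_ ?_ (fun M h1 hE hS => ?_) x
  · rintro _ ⟨j, t, hij, rfl⟩
    rw [hκ]
    refine Subalgebra.smul_mem _ (Algebra.subset_adjoin ?_) _
    exact ⟨j, t, hij, rfl⟩
  · rintro _ ⟨j, t, hij, rfl⟩
    rw [hκ, smul_mul_assoc, ← braidSeq]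
    refine Algebra.subset_adjoin ?_
    exact ⟨j, t + 1, hij, rfl⟩
  · refine Uplus_left_induction M h1 fun j y hy => ?_
    by_cases hij : i = j
    · exact hij ▸ hE y hy
    · exact hS _ ⟨j, 0, hij, rfl⟩ y hy

theorem skewDerivation_adjoin {k A : Type*} [Field k] [Ring A] [Algebra k A] {δ : A →ₗ[k] A}
    {κ : A →ₐ[k] A} (hδ : ∀ x y, δ (x * y) = δ x * κ y + x * δ y) (h1 : δ 1 = 0) {S : Set A}
    (hS : ∀ s ∈ S, δ s = 0) (y : A) (hy : y ∈ Algebra.adjoin k S) : δ y = 0 := by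
  induction hy using Algebra.adjoin_induction with
  | mem y hy => exact hS y hy
  | algebraMap c => rw [Algebra.algebraMap_eq_smul_one, map_smul, h1, smul_zero]
  | add y z _ _ hy hz => rw [map_add, hy, hz, add_zero]
  | mul y z _ _ hy hz => rw [hδ, hy, hz, zero_mul, mul_zero, add_zero]

theorem DerProp.map_braidSeq {ri : Fin n → ((Uplus a d r) →ₗ[Kq] (Uplus a d r))}
    (hri : DerProp a d r ri) (hC : CartanData n a d r) {i j : Fin n} (hij : i ≠ j) (t : ℕ) :
    ri i (braidSeq (qi d i ^ a i j) (qi d i ^ 2) (Eplus a d r i) (Eplus a d r j) t) = 0 := by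
  have he : KConj a d r i (Eplus a d r i) = qi d i ^ 2 • Eplus a d r i := by
    rw [KConj_Eplus, hC.diag]
    rfl
  refine skewDerivation_braidSeq (A := Uplus a d r) (δ := ri i) (κ := KConj a d r i)
    (hri.map_mul i) he (KConj_Eplus i j) ?_ ?_ t
  · rw [(hri i).2.1, if_pos rfl]
  · rw [(hri i).2.1, if_neg hij]

theorem add_sub_mul_eq_zero {A : Type*} [Ring A] {s v w y : A} (h : w * y = s + v * y) :
    s + (v - w) * y = 0 := by
  rw [sub_mul, h]
  abel

end Kernel

/-- For `x ∈ U⁺` one has `r_i(x) = 0` iff `T_i⁻¹(x) ∈ U⁺`. -/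
theorem twisted_derivation_kernel {n : ℕ} (a : Fin n → Fin n → ℤ)
    (d r : Fin n → ℕ) (hC : CartanData n a d r)
    (ri : Fin n → ((Uplus a d r) →ₗ[Kq] (Uplus a d r))) (hri : DerProp a d r ri)
    (i : Fin n) (T : Uq a d r ≃ₐ[Kq] Uq a d r) (hT : TCond a d r i T)
    (x : Uplus a d r) :
    ri i x = 0 ↔ T.symm (x : Uq a d r) ∈ Uplus a d r := by
  obtain ⟨N, c, hc, hx⟩ := exists_Eplus_expansion hC i x
  have he : KConj a d r i (Eplus a d r i) = qi d i ^ 2 • Eplus a d r i := by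
    rw [KConj_Eplus, hC.diag]
    rfl
  have hre : ri i (Eplus a d r i) = 1 := by rw [(hri i).2.1, if_pos rfl]
  have hrc (m : ℕ) : ri i (c m) = 0 := by
    refine skewDerivation_adjoin (A := Uplus a d r) (δ := ri i) (κ := KConj a d r i)
      (hri.map_mul i) (hri i).1 ?_ _ (hc m)
    rintro _ ⟨j, t, hij, rfl⟩
    exact hri.map_braidSeq hC hij t
  have hTc (m : ℕ) : T.symm (c m : Uq a d r) ∈ Uplus a d r := by
    have hle : Algebra.adjoin Kq {y : Uplus a d r | ∃ j t, i ≠ j ∧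
        y = braidSeq (qi d i ^ a i j) (qi d i ^ 2) (Eplus a d r i) (Eplus a d r j) t} ≤
        (Uplus a d r).comap ((T.symm : Uq a d r →ₐ[Kq] Uq a d r).comp (Uplus a d r).val) := by
      refine Algebra.adjoin_le ?_
      rintro _ ⟨j, t, hij, rfl⟩
      have h' := map_braidSeq (Uplus a d r).val (qi d i ^ a i j) (qi d i ^ 2)
        (Eplus a d r i) (Eplus a d r j) t
      change T.symm ((Uplus a d r).val _) ∈ Uplus a d r
      rw [h']
      exact hT.symm_braidSeq_mem hC hij t
    exact hle (hc m)
  have hx0 (h : ∀ m < N, c (m + 1) = 0) : x = c 0 := by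
    rw [hx, Finset.sum_range_succ', pow_zero, mul_one, Finset.sum_eq_zero, zero_add]
    intro m hm
    rw [h m (Finset.mem_range.1 hm), zero_mul]
  have hQ1 (m : ℕ) (hm : m ≠ 0) : (qi d i ^ 2) ^ m ≠ 1 := by
    rw [← pow_mul]
    exact qi_pow_ne_one (hC.d_pos i) (by omega)
  have hQ : qi d i ^ 2 ≠ 1 := by simpa using hQ1 1 one_ne_zero
  constructor
  · intro h
    have hzero := coeff_eq_zero_of_skewDerivation (A := Uplus a d r) (δ := ri i)
      (κ := KConj a d r i) (hri.map_mul i) he hre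
      (fun m => by
        rw [geom_sum_eq hQ]
        exact div_ne_zero (sub_ne_zero.2 (hQ1 _ m.succ_ne_zero)) (sub_ne_zero.2 hQ))
      N c hrc (hx ▸ h)
    rw [hx0 hzero]
    exact hTc 0
  · intro h
    obtain ⟨ρ, hρu, hρ1, hρe⟩ := hri.exists_lowering_rep hC i
    let v : ℕ → Uplus a d r := fun m => ⟨T.symm (c m : Uq a d r), hTc m⟩
    let u : ℕ → Uplus a d r := fun m => if m = 0 then v 0 - ⟨T.symm (x : Uq a d r), h⟩ else v m
    have hsum (y : Uplus a d r) : ∑ m ∈ Finset.range (N + 1), u m *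
        ((ρ (-(gen a d r (Gen.Kinv i) * gen a d r (Gen.F i)))) ^ m) y = 0 := by
      have hxT : T.symm (x : Uq a d r) = ∑ m ∈ Finset.range (N + 1),
          (v m : Uq a d r) * (-(gen a d r (Gen.Kinv i) * gen a d r (Gen.F i))) ^ m := by
        conv_lhs => rw [hx]
        rw [AddSubmonoidClass.coe_finsetSum, map_sum]
        refine Finset.sum_congr rfl fun m _ => ?_
        rw [MulMemClass.coe_mul, map_mul, SubmonoidClass.coe_pow, map_pow]
        exact congrArg (fun z => (v m : Uq a d r) * z ^ m) (hT.symm_E hC)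
      have hρx := congrArg (fun z => ρ z y) hxT
      simp only [map_sum, map_mul, map_pow, LinearMap.sum_apply, Module.End.mul_apply, hρu] at hρx
      have hx' : ρ (T.symm (x : Uq a d r)) y = ⟨T.symm (x : Uq a d r), h⟩ * y :=
        hρu ⟨T.symm (x : Uq a d r), h⟩ y
      rw [hx', Finset.sum_range_succ'] at hρx
      rw [Finset.sum_range_succ']
      simp only [u, Nat.succ_ne_zero, if_false, if_true, pow_zero, Module.End.one_apply]
        at hρx ⊢
      exact add_sub_mul_eq_zero (A := Uplus a d r) hρx
    have hu := coeff_eq_zero_of_lowering hρ1 hρe (N + 1) u hsum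
    have hzero (m : ℕ) (hm : m < N) : c (m + 1) = 0 := by
      have h1 : v (m + 1) = 0 := hu (m + 1) (by omega)
      have h2 : T.symm (c (m + 1) : Uq a d r) = 0 := congrArg Subtype.val h1
      exact Subtype.ext ((map_eq_zero_iff T.symm T.symm.injective).1 h2)
    rw [hx0 hzero]
    exact hrc 0

end
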